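/- arXiv:1603.04964 — 2 statements merged into one kernel-verified Lean document; each statement's English description precedes it below -/
import Mathlib

section
/- Let x̂_{k:N} ∈ S^(N−k+1) and let f_{k:N} be a non-degenerate randomized policy, with cost-to-go functions V_j for the pair (f_{k:N}, x̂_{k:N}). Then f_{k:N} ∈ 𝔓(x̂_{k:N}) if and only if for every j ∈ {k, …, N}, ∫_S V_j(x) μ_{j|j−1}(dx) = ∫_S J*_j(x, x̂_{j:N}) μ_{j|j−1}(dx). -/
open MeasureTheory Filter
open scoped ENNReal NNReal Topology

noncomputable section

/-- The state space `S = ℝ² × [0, 2π)`. -/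
abbrev S : Type := {x : ℝ × ℝ × ℝ // x.2.2 ∈ Set.Ico (0 : ℝ) (2 * Real.pi)}

/-- The metric `d` on `S`. -/
noncomputable def dS (x y : S) : ℝ :=
  Real.sqrt ((x.1.1 - y.1.1) ^ 2 + (x.1.2.1 - y.1.2.1) ^ 2
    + 2 * (Real.cos x.1.2.2 - Real.cos y.1.2.2) ^ 2
    + 2 * (Real.sin x.1.2.2 - Real.sin y.1.2.2) ^ 2)

/-- The initial state `x₀ = (0,0,0)`. -/
def origin : S := ⟨(0, 0, 0), ⟨le_rfl, by positivity⟩⟩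

/-- `κ` is a Markov kernel on `S`. -/
def IsMarkov (κ : S → Measure S) : Prop :=
  (∀ x, IsProbabilityMeasure (κ x)) ∧
    ∀ A : Set S, MeasurableSet A → Measurable fun x => κ x A

/-- Continuity of a real-valued function with respect to the metric `dS`. -/
def DContinuous (g : S → ℝ) : Prop :=
  ∀ x : S, ∀ ε : ℝ, 0 < ε → ∃ δ : ℝ, 0 < δ ∧ ∀ y : S, dS x y < δ → |g y - g x| < ε

/-- Openness with respect to the metric `dS`. -/
def DOpen (O : Set S) : Prop :=
  ∀ x ∈ O, ∃ δ : ℝ, 0 < δ ∧ ∀ y : S, dS x y < δ → y ∈ O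

/-- Assumption 1 on the kernel `κ`. -/
def Assumption1 (κ : S → Measure S) : Prop :=
  (∀ A : Set S, MeasurableSet A → DContinuous fun x => (κ x A).toReal) ∧
    ∀ O : Set S, DOpen O → O.Nonempty → ∀ x : S, 0 < κ x O

/-- Auxiliary downward value recursion; the first argument is the number
`N + 1 - j` of remaining stages. -/
noncomputable def Jaux (κ : S → Measure S) (c' : ℕ → ℝ) (xhat : ℕ → S) :
    ℕ → ℕ → S → ℝ≥0∞
  | 0, _, _ => 0
  | m + 1, j, x =>
      min (ENNReal.ofReal (dS x (xhat j) ^ 2) + ∫⁻ y, Jaux κ c' xhat m (j + 1) y ∂(κ x))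
        (ENNReal.ofReal (c' j))

/-- The optimal cost-to-go `J*_j(x, x̂_{j:N})`. -/
noncomputable def JJ (κ : S → Measure S) (c' : ℕ → ℝ) (N : ℕ) (xhat : ℕ → S)
    (j : ℕ) (x : S) : ℝ≥0∞ :=
  Jaux κ c' xhat (N + 1 - j) j x

/-- `G_j(x, x̂_{j:N}) = ∫ J*_j(y, x̂_{j:N}) κ(x)(dy)`. -/
noncomputable def Gj (κ : S → Measure S) (c' : ℕ → ℝ) (N : ℕ) (xhat : ℕ → S)
    (j : ℕ) (x : S) : ℝ≥0∞ :=
  ∫⁻ y, JJ κ c' N xhat j y ∂(κ x)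

/-- `G(x̂_{k:N}) = G_k(x₀, x̂_{k:N})`. -/
noncomputable def Gtot (κ : S → Measure S) (c' : ℕ → ℝ) (k N : ℕ) (xhat : ℕ → S) : ℝ≥0∞ :=
  Gj κ c' N xhat k origin

/-- A randomized policy: a tuple of Borel measurable functions `f_j : S → [0,1]`. -/
def IsPolicy (k N : ℕ) (f : ℕ → S → ℝ≥0∞) : Prop :=
  ∀ j, k ≤ j → j ≤ N → Measurable (f j) ∧ ∀ x, f j x ≤ 1

/-- Auxiliary cost-to-go recursion for a policy; first argument is `N + 1 - j`. -/
noncomputable def Vaux (κ : S → Measure S) (c' : ℕ → ℝ) (xhat : ℕ → S)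
    (f : ℕ → S → ℝ≥0∞) : ℕ → ℕ → S → ℝ≥0∞
  | 0, _, _ => 0
  | m + 1, j, x =>
      f j x * (ENNReal.ofReal (dS x (xhat j) ^ 2) + ∫⁻ y, Vaux κ c' xhat f m (j + 1) y ∂(κ x))
        + (1 - f j x) * ENNReal.ofReal (c' j)

/-- The cost-to-go `V_j` of a policy `f` with estimates `x̂`. -/
noncomputable def VV (κ : S → Measure S) (c' : ℕ → ℝ) (N : ℕ) (xhat : ℕ → S)
    (f : ℕ → S → ℝ≥0∞) (j : ℕ) (x : S) : ℝ≥0∞ :=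
  Vaux κ c' xhat f (N + 1 - j) j x

/-- The total expected cost `C(f_{k:N}, x̂_{k:N})`. -/
noncomputable def Cost (κ : S → Measure S) (c' : ℕ → ℝ) (k N : ℕ) (xhat : ℕ → S)
    (f : ℕ → S → ℝ≥0∞) : ℝ≥0∞ :=
  ∫⁻ y, VV κ c' N xhat f k y ∂(κ origin)

/-- `f ∈ 𝔓(x̂_{k:N})`: `f` minimizes the cost over all randomized policies. -/
def inP (κ : S → Measure S) (c' : ℕ → ℝ) (k N : ℕ) (xhat : ℕ → S)
    (f : ℕ → S → ℝ≥0∞) : Prop :=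
  IsPolicy k N f ∧
    ∀ g : ℕ → S → ℝ≥0∞, IsPolicy k N g → Cost κ c' k N xhat f ≤ Cost κ c' k N xhat g

/-- `x̂ ∈ 𝔛(f_{k:N})`: the estimates minimize the cost for the policy `f`. -/
def inX (κ : S → Measure S) (c' : ℕ → ℝ) (k N : ℕ) (f : ℕ → S → ℝ≥0∞)
    (xhat : ℕ → S) : Prop :=
  ∀ yhat : ℕ → S, Cost κ c' k N xhat f ≤ Cost κ c' k N yhat f

/-- Conditioning a measure on "no transmission" at stage `j`. -/
noncomputable def condMeas (f : ℕ → S → ℝ≥0∞) (j : ℕ) (μ : Measure S) : Measure S :=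
  (∫⁻ x, f j x ∂μ)⁻¹ • μ.withDensity (f j)

/-- The predicted measures `μ_{j|j−1}`, by recursion on `j - k`. -/
noncomputable def mupredAux (κ : S → Measure S) (f : ℕ → S → ℝ≥0∞) (k : ℕ) :
    ℕ → Measure S
  | 0 => κ origin
  | n + 1 => (condMeas f (k + n) (mupredAux κ f k n)).bind κ

/-- `μ_{j|j−1}`. -/
noncomputable def mupred (κ : S → Measure S) (f : ℕ → S → ℝ≥0∞) (k j : ℕ) : Measure S :=
  mupredAux κ f k (j - k)

/-- `q_j = ∫ f_j dμ_{j|j−1}`. -/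
noncomputable def qq (κ : S → Measure S) (f : ℕ → S → ℝ≥0∞) (k j : ℕ) : ℝ≥0∞ :=
  ∫⁻ x, f j x ∂(mupred κ f k j)

/-- `μ_{j|j}`. -/
noncomputable def mucond (κ : S → Measure S) (f : ℕ → S → ℝ≥0∞) (k j : ℕ) : Measure S :=
  condMeas f j (mupred κ f k j)

/-- Non-degeneracy of a policy. -/
def NonDeg (κ : S → Measure S) (f : ℕ → S → ℝ≥0∞) (k N : ℕ) : Prop :=
  ∀ j, k ≤ j → j ≤ N → 0 < qq κ f k j

/-- The closed "no transmission" region `D̄_j`. -/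
noncomputable def Dbar (κ : S → Measure S) (c' : ℕ → ℝ) (N : ℕ) (xhat : ℕ → S)
    (j : ℕ) : Set S :=
  {x : S | ENNReal.ofReal (dS x (xhat j) ^ 2) + ∫⁻ y, JJ κ c' N xhat (j + 1) y ∂(κ x)
      ≤ ENNReal.ofReal (c' j)}

/-- The open "no transmission" region `Ḏ_j`. -/
noncomputable def Dund (κ : S → Measure S) (c' : ℕ → ℝ) (N : ℕ) (xhat : ℕ → S)
    (j : ℕ) : Set S :=
  {x : S | ENNReal.ofReal (dS x (xhat j) ^ 2) + ∫⁻ y, JJ κ c' N xhat (j + 1) y ∂(κ x)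
      < ENNReal.ofReal (c' j)}

/-- Hypothesis (H). -/
def HypH (κ : S → Measure S) (c' : ℕ → ℝ) (k N : ℕ) : Prop :=
  ∀ j, k ≤ j → j ≤ N → ∃ xhat : ℕ → S, (Dund κ c' N xhat j).Nonempty

/-- Weak convergence of measures on `(S, dS)`: tested against `dS`-continuous
bounded functions. -/
def WeakConvS (μl : ℕ → Measure S) (μ : Measure S) : Prop :=
  ∀ h : S → ℝ, DContinuous h → (∃ C : ℝ, ∀ x, |h x| ≤ C) →
    Tendsto (fun l => ∫ x, h x ∂(μl l)) atTop (𝓝 (∫ x, h x ∂μ))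

/-- Convergence of a sequence of (non-degenerate) policies to a policy. -/
def PolConv (κ : S → Measure S) (k N : ℕ) (g : ℕ → ℕ → S → ℝ≥0∞)
    (f : ℕ → S → ℝ≥0∞) : Prop :=
  ∀ j, k ≤ j → j ≤ N →
    WeakConvS (fun l => mucond κ (g l) k j) (mucond κ f k j) ∧
      Tendsto (fun l => qq κ (g l) k j) atTop (𝓝 (qq κ f k j))

theorem aux_kmeas {κ : S → Measure S} (hκ : IsMarkov κ) : Measurable κ :=
  Measure.measurable_of_measurable_coe κ hκ.2

theorem aux_dmeas (y : S) : Measurable fun x : S => ENNReal.ofReal (dS x y ^ 2) := by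
  unfold dS
  fun_prop

theorem aux_int {κ : S → Measure S} (hκ : IsMarkov κ) {h : S → ℝ≥0∞} (hh : Measurable h) :
    Measurable fun x => ∫⁻ y, h y ∂(κ x) :=
  (Measure.measurable_lintegral hh).comp (aux_kmeas hκ)

theorem aux_Jmeas {κ : S → Measure S} (hκ : IsMarkov κ) (c' : ℕ → ℝ) (xhat : ℕ → S) (m : ℕ) :
    ∀ j, Measurable (Jaux κ c' xhat m j) := by
  induction m with
  | zero => intro j; exact measurable_const
  | succ m ih =>
    intro j
    exact ((aux_dmeas (xhat j)).add (aux_int hκ (ih (j + 1)))).min measurable_const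

theorem aux_Vmeas {κ : S → Measure S} (hκ : IsMarkov κ) (c' : ℕ → ℝ) (xhat : ℕ → S)
    {k N : ℕ} {f : ℕ → S → ℝ≥0∞} (hf : IsPolicy k N f) (m : ℕ) :
    ∀ j, k ≤ j → j + m = N + 1 → Measurable (Vaux κ c' xhat f m j) := by
  induction m with
  | zero => intro j _ _; exact measurable_const
  | succ m ih =>
    intro j hj hm
    have hfj := (hf j hj (by omega)).1
    exact (hfj.mul ((aux_dmeas (xhat j)).add (aux_int hκ (ih (j + 1) (by omega) (by omega))))).add
      ((measurable_const.sub hfj).mul measurable_const)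

theorem aux_min_le {a b p : ℝ≥0∞} (hp : p ≤ 1) : min a b ≤ p * a + (1 - p) * b := by
  calc min a b = (p + (1 - p)) * min a b := by rw [add_tsub_cancel_of_le hp, one_mul]
    _ = p * min a b + (1 - p) * min a b := add_mul _ _ _
    _ ≤ _ := by gcongr; exacts [min_le_left _ _, min_le_right _ _]

theorem aux_J_le_V {κ : S → Measure S} (c' : ℕ → ℝ) (xhat : ℕ → S)
    {k N : ℕ} {f : ℕ → S → ℝ≥0∞} (hf : IsPolicy k N f) (m : ℕ) :
    ∀ j, k ≤ j → j + m = N + 1 → ∀ x, Jaux κ c' xhat m j x ≤ Vaux κ c' xhat f m j x := by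
  induction m with
  | zero => intro j _ _ x; exact le_rfl
  | succ m ih =>
    intro j hj hm x
    have hfj := (hf j hj (by omega)).2 x
    refine (aux_min_le hfj).trans ?_
    have := lintegral_mono (μ := κ x) (ih (j + 1) (by omega) (by omega))
    simp only [Vaux]
    gcongr

/-- The optimal threshold policy. -/
def gopt (κ : S → Measure S) (c' : ℕ → ℝ) (N : ℕ) (xhat : ℕ → S) (j : ℕ) : S → ℝ≥0∞ :=
  (Dbar κ c' N xhat j).indicator 1

theorem aux_gopt {κ : S → Measure S} (hκ : IsMarkov κ) (c' : ℕ → ℝ) (k N : ℕ) (xhat : ℕ → S) :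
    IsPolicy k N (gopt κ c' N xhat) := by
  intro j _ _
  refine ⟨measurable_one.indicator ?_, fun x => ?_⟩
  · exact measurableSet_le ((aux_dmeas (xhat j)).add (aux_int hκ (aux_Jmeas hκ c' xhat _ _)))
      measurable_const
  · exact Set.indicator_le_self' (fun _ _ => zero_le') x

theorem aux_V_gopt (κ : S → Measure S) (c' : ℕ → ℝ) (N : ℕ) (xhat : ℕ → S) (m : ℕ) :
    ∀ j, j + m = N + 1 → ∀ x,
      Vaux κ c' xhat (gopt κ c' N xhat) m j x = Jaux κ c' xhat m j x := by
  induction m with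
  | zero => intro j _ x; rfl
  | succ m ih =>
    intro j hm x
    have hN : N + 1 - (j + 1) = m := by omega
    simp only [Vaux, Jaux, ih (j + 1) (by omega)]
    by_cases hx : x ∈ Dbar κ c' N xhat j
    · have h1 : gopt κ c' N xhat j x = 1 := Set.indicator_of_mem hx _
      simp only [Dbar, Set.mem_setOf_eq, JJ, hN] at hx
      rw [h1, min_eq_left hx]; simp
    · have h1 : gopt κ c' N xhat j x = 0 := Set.indicator_of_notMem hx _
      simp only [Dbar, Set.mem_setOf_eq, JJ, hN, not_le] at hx
      rw [h1, min_eq_right hx.le]; simp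

theorem aux_mass {κ : S → Measure S} (hκ : IsMarkov κ) {k N : ℕ} {f : ℕ → S → ℝ≥0∞} (n : ℕ) :
    mupredAux κ f k n Set.univ ≤ 1 := by
  cases n with
  | zero => exact (hκ.1 origin).measure_univ.le
  | succ n =>
    simp only [mupredAux]
    rw [Measure.bind_apply MeasurableSet.univ (aux_kmeas hκ).aemeasurable]
    have : ∀ x, κ x Set.univ = 1 := fun x => (hκ.1 x).measure_univ
    simp only [this, lintegral_one, condMeas, Measure.smul_apply, smul_eq_mul]
    rw [withDensity_apply _ MeasurableSet.univ, Measure.restrict_univ]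
    exact ENNReal.inv_mul_le_one _

theorem aux_next {κ : S → Measure S} (hκ : IsMarkov κ) {k : ℕ} {f : ℕ → S → ℝ≥0∞} (n : ℕ)
    (hf : Measurable (f (k + n))) {h : S → ℝ≥0∞} (hh : Measurable h) :
    ∫⁻ x, h x ∂(mupredAux κ f k (n + 1)) =
      (∫⁻ x, f (k + n) x ∂(mupredAux κ f k n))⁻¹ *
        ∫⁻ x, f (k + n) x * ∫⁻ y, h y ∂(κ x) ∂(mupredAux κ f k n) := by
  simp only [mupredAux, condMeas]
  rw [Measure.lintegral_bind (aux_kmeas hκ).aemeasurable hh.aemeasurable, lintegral_smul_measure,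
    lintegral_withDensity_eq_lintegral_mul _ hf (aux_int hκ hh)]
  rfl

theorem aux_step {κ : S → Measure S} (hκ : IsMarkov κ) {k N : ℕ} (c' : ℕ → ℝ) (xhat : ℕ → S)
    {f : ℕ → S → ℝ≥0∞} (hf : IsPolicy k N f) (n m : ℕ) (hm : k + n + (m + 1) = N + 1)
    (h : ∫⁻ x, Vaux κ c' xhat f (m + 1) (k + n) x ∂(mupredAux κ f k n) =
      ∫⁻ x, Jaux κ c' xhat (m + 1) (k + n) x ∂(mupredAux κ f k n)) :
    ∫⁻ x, Vaux κ c' xhat f m (k + n + 1) x ∂(mupredAux κ f k (n + 1)) =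
      ∫⁻ x, Jaux κ c' xhat m (k + n + 1) x ∂(mupredAux κ f k (n + 1)) := by
  have hfj := hf (k + n) (by omega) (by omega)
  rw [aux_next hκ n hfj.1 (aux_Vmeas hκ c' xhat hf m _ (by omega) (by omega)),
    aux_next hκ n hfj.1 (aux_Jmeas hκ c' xhat m _)]
  congr 1
  have hfin : ∫⁻ x, Jaux κ c' xhat (m + 1) (k + n) x ∂(mupredAux κ f k n) ≠ ∞ := by
    have h1 : ∫⁻ x, Jaux κ c' xhat (m + 1) (k + n) x ∂(mupredAux κ f k n) ≤
        ∫⁻ _, ENNReal.ofReal (c' (k + n)) ∂(mupredAux κ f k n) :=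
      lintegral_mono fun x => min_le_right _ _
    rw [lintegral_const] at h1
    exact ne_top_of_le_ne_top (ENNReal.mul_ne_top ENNReal.ofReal_ne_top
      (ne_top_of_le_ne_top ENNReal.one_ne_top (aux_mass (N := N) hκ n))) h1
  have hae := ae_eq_of_ae_le_of_lintegral_le
    (Eventually.of_forall (aux_J_le_V (κ := κ) c' xhat hf (m + 1) (k + n) (by omega) hm)) hfin
    (aux_Vmeas hκ c' xhat hf (m + 1) _ (by omega) hm).aemeasurable h.le
  refine lintegral_congr_ae ?_
  filter_upwards [hae] with x hx
  have hp := hfj.2 x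
  have hJV := lintegral_mono (μ := κ x)
    (aux_J_le_V (κ := κ) c' xhat hf m (k + n + 1) (by omega) (by omega))
  refine le_antisymm ?_ (by gcongr)
  have h2 : Vaux κ c' xhat f (m + 1) (k + n) x ≤ _ := hx.symm.le.trans (aux_min_le hp)
  simp only [Vaux] at h2
  have hpt : f (k + n) x ≠ ∞ := ne_top_of_le_ne_top ENNReal.one_ne_top hp
  rw [ENNReal.add_le_add_iff_right (ENNReal.mul_ne_top (ne_top_of_le_ne_top ENNReal.one_ne_top
    tsub_le_self) ENNReal.ofReal_ne_top), mul_add, mul_add,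
    ENNReal.add_le_add_iff_left (ENNReal.mul_ne_top hpt ENNReal.ofReal_ne_top)] at h2
  exact h2

/-- A non-degenerate policy `f` belongs to `𝔓(x̂_{k:N})` iff its cost-to-go agrees
in `μ_{j|j−1}`-mean with the optimal cost-to-go `J*_j`, for every `j`. -/
theorem best_response_policies_characterization (κ : S → Measure S) (hκ : IsMarkov κ)
    (k N : ℕ) (hkN : k ≤ N) (c' : ℕ → ℝ) (hc' : ∀ j, k ≤ j → j ≤ N → 0 < c' j)
    (xhat : ℕ → S) (f : ℕ → S → ℝ≥0∞) (hf : IsPolicy k N f)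
    (hnd : NonDeg κ f k N) :
    inP κ c' k N xhat f ↔
      ∀ j, k ≤ j → j ≤ N →
        ∫⁻ x, VV κ c' N xhat f j x ∂(mupred κ f k j) =
          ∫⁻ x, JJ κ c' N xhat j x ∂(mupred κ f k j) := by
  have hCopt : Cost κ c' k N xhat (gopt κ c' N xhat) = ∫⁻ x, JJ κ c' N xhat k x ∂(κ origin) :=
    lintegral_congr fun x => aux_V_gopt κ c' N xhat _ k (by omega) x
  have hmk : mupred κ f k k = κ origin := by simp [mupred, mupredAux]
  constructor
  · rintro ⟨-, hopt⟩ j hj hjN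
    obtain ⟨n, rfl⟩ := Nat.exists_eq_add_of_le hj
    clear hj
    simp only [VV, JJ, mupred, Nat.add_sub_cancel_left]
    induction n with
    | zero =>
      refine le_antisymm ?_ (lintegral_mono
        (aux_J_le_V c' xhat hf (N + 1 - (k + 0)) (k + 0) (by omega) (by omega)))
      exact (hopt _ (aux_gopt hκ c' k N xhat)).trans hCopt.le
    | succ n ih =>
      have h1 := ih (by omega)
      obtain ⟨m, hm⟩ : ∃ m, N + 1 - (k + (n + 1)) = m := ⟨_, rfl⟩
      have hm' : N + 1 - (k + n) = m + 1 := by omega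
      rw [hm'] at h1
      rw [hm]
      exact aux_step hκ c' xhat hf n m (by omega) h1
  · intro h
    refine ⟨hf, fun g hg => ?_⟩
    have h1 := h k le_rfl hkN
    rw [hmk] at h1
    refine h1.le.trans (lintegral_mono (aux_J_le_V c' xhat hg _ k le_rfl (by omega)))

end
end

section
/- Suppose κ satisfies Assumption 1. Let (f^(i), x̂^(i))_{i ≥ 1} satisfy f^(i) ∈ 𝔓(x̂^(i−1)) and x̂^(i) ∈ 𝔛(f^(i)) for every i (with x̂^(0) given), and suppose the sequence of policies (f^(i)) is strictly non-degenerate. Then: (a) there exist an infinite subset {i_l} of ℕ, estimates x̂_{k:N} ∈ S^(N−k+1), and a non-degenerate policy f_{k:N} such that x̂^(i_l) converges componentwise in d to x̂_{k:N} and f^(i_l) converges to f_{k:N}; and (b) for every such convergent subsequence and limit pair, (f_{k:N}, x̂_{k:N}) is person-by-person optimal: f_{k:N} ∈ 𝔓(x̂_{k:N}) and x̂_{k:N} ∈ 𝔛(f_{k:N}). -/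
open MeasureTheory Filter
open scoped ENNReal NNReal Topology

noncomputable section

set_option linter.unusedSectionVars false

section Gen
variable {X : Type*} [MetricSpace X] [ProperSpace X] [MeasurableSpace X] [BorelSpace X]

def GPol (L : ℕ) (f : ℕ → X → ℝ≥0∞) : Prop := ∀ n < L, Measurable (f n) ∧ ∀ x, f n x ≤ 1

def gU (κ : X → Measure X) (x0 : X) (f : ℕ → X → ℝ≥0∞) : ℕ → Measure X
  | 0 => κ x0
  | n + 1 => ((gU κ x0 f n).withDensity (f n)).bind κ

def gtm (c : ℕ → ℝ≥0∞) (xh : ℕ → X) (f : ℕ → X → ℝ≥0∞) (n : ℕ) (x : X) : ℝ≥0∞ :=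
  f n x * ENNReal.ofReal (dist x (xh n) ^ 2) + (1 - f n x) * c n

def gC (κ : X → Measure X) (x0 : X) (c : ℕ → ℝ≥0∞) (L : ℕ) (xh : ℕ → X)
    (f : ℕ → X → ℝ≥0∞) : ℝ≥0∞ :=
  ∑ n ∈ Finset.range L, ∫⁻ x, gtm c xh f n x ∂(gU κ x0 f n)

def gcond (f : ℕ → X → ℝ≥0∞) (n : ℕ) (μ : Measure X) : Measure X :=
  (∫⁻ x, f n x ∂μ)⁻¹ • μ.withDensity (f n)

def gm (κ : X → Measure X) (x0 : X) (f : ℕ → X → ℝ≥0∞) : ℕ → Measure X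
  | 0 => κ x0
  | n + 1 => (gcond f n (gm κ x0 f n)).bind κ

def gq (κ : X → Measure X) (x0 : X) (f : ℕ → X → ℝ≥0∞) (n : ℕ) : ℝ≥0∞ :=
  ∫⁻ x, f n x ∂(gm κ x0 f n)

def gV (κ : X → Measure X) (c : ℕ → ℝ≥0∞) (xh : ℕ → X) (f : ℕ → X → ℝ≥0∞) :
    ℕ → ℕ → X → ℝ≥0∞
  | 0, _, _ => 0
  | m + 1, j, x =>
      f j x * (ENNReal.ofReal (dist x (xh j) ^ 2) + ∫⁻ y, gV κ c xh f m (j + 1) y ∂(κ x))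
        + (1 - f j x) * c j

variable {κ : X → Measure X} {x0 : X} {c : ℕ → ℝ≥0∞} {L : ℕ} {f : ℕ → X → ℝ≥0∞}

lemma measurable_dsq (y : X) :
    Measurable fun x : X => ENNReal.ofReal (dist x y ^ 2) := by fun_prop

lemma measurable_gtm (xh : ℕ → X) (hf : GPol L f) {n : ℕ} (hn : n < L) :
    Measurable (gtm c xh f n) := by
  have := (hf n hn).1
  unfold gtm
  exact (this.mul (measurable_dsq _)).add ((measurable_const.sub this).mul_const _)

lemma measurable_gV (hκ : Measurable κ) (xh : ℕ → X) (hf : GPol L f) :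
    ∀ m n, n + m ≤ L → Measurable (gV κ c xh f m n)
  | 0, _, _ => measurable_const
  | m + 1, n, h => by
    have h1 := (hf n (by omega)).1
    have h2 := measurable_gV hκ xh hf m (n+1) (by omega)
    have h3 : Measurable fun x => ∫⁻ y, gV κ c xh f m (n + 1) y ∂(κ x) :=
      (Measure.measurable_lintegral h2).comp hκ
    exact (h1.mul ((measurable_dsq _).add h3)).add ((measurable_const.sub h1).mul_const _)

lemma lintegral_gV (hκ : Measurable κ) (xh : ℕ → X) (hf : GPol L f) :
    ∀ m n, n + m ≤ L → ∫⁻ x, gV κ c xh f m n x ∂(gU κ x0 f n)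
      = ∑ i ∈ Finset.range m, ∫⁻ x, gtm c xh f (n + i) x ∂(gU κ x0 f (n + i))
  | 0, _, _ => by simp [gV]
  | m + 1, n, h => by
    have h1 := (hf n (by omega)).1
    have h2 := measurable_gV (c := c) hκ xh hf m (n+1) (by omega)
    have h3 : Measurable fun x => ∫⁻ y, gV κ c xh f m (n + 1) y ∂(κ x) :=
      (Measure.measurable_lintegral h2).comp hκ
    have ih := lintegral_gV hκ xh hf m (n+1) (by omega)
    rw [Finset.sum_range_succ']
    have e : ∀ i, n + (i + 1) = n + 1 + i := by intro i; omega
    have e' : ∑ i ∈ Finset.range m, ∫⁻ x, gtm c xh f (n + (i + 1)) x ∂(gU κ x0 f (n + (i + 1)))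
        = ∑ i ∈ Finset.range m, ∫⁻ x, gtm c xh f (n + 1 + i) x ∂(gU κ x0 f (n + 1 + i)) :=
      Finset.sum_congr rfl fun i _ => by rw [e]
    rw [e', ← ih, add_zero, gU, Measure.lintegral_bind hκ.aemeasurable h2.aemeasurable,
      lintegral_withDensity_eq_lintegral_mul _ h1 h3, ← lintegral_add_left (h1.mul h3)]
    apply lintegral_congr
    intro x
    simp only [gV, gtm, Pi.mul_apply]
    ring

lemma gC_eq (hκ : Measurable κ) (xh : ℕ → X) (hf : GPol L f) :
    ∫⁻ x, gV κ c xh f L 0 x ∂(κ x0) = gC κ x0 c L xh f := by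
  have := lintegral_gV (c := c) (x0 := x0) hκ xh hf L 0 (by omega)
  simpa [gU, gC] using this

variable [hp : ∀ x, IsProbabilityMeasure (κ x)]

lemma bind_univ (hκ : Measurable κ) (μ : Measure X) : (μ.bind κ) Set.univ = μ Set.univ := by
  rw [Measure.bind_apply MeasurableSet.univ hκ.aemeasurable]; simp

lemma gU_univ_succ (hκ : Measurable κ) (n : ℕ) :
    gU κ x0 f (n+1) Set.univ = ∫⁻ x, f n x ∂(gU κ x0 f n) := by
  rw [gU, bind_univ hκ, withDensity_apply _ MeasurableSet.univ]; simp

lemma gU_univ_le (hκ : Measurable κ) (hf : GPol L f) : ∀ n ≤ L, gU κ x0 f n Set.univ ≤ 1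
  | 0, _ => by simp [gU]
  | n + 1, h => by
    rw [gU_univ_succ hκ]
    refine le_trans (lintegral_mono fun x => (hf n (by omega)).2 x) ?_
    simpa using gU_univ_le hκ hf n (by omega)

lemma gq_le (hf : GPol L f) {n : ℕ} (hn : n < L) [IsProbabilityMeasure (gm κ x0 f n)] :
    gq κ x0 f n ≤ 1 := by
  refine le_trans (lintegral_mono fun x => (hf n (by omega)).2 x) ?_
  simp

lemma gcond_prob (hf : GPol L f) {n : ℕ} (hn : n < L) (h1 : IsProbabilityMeasure (gm κ x0 f n))
    (h0 : gq κ x0 f n ≠ 0) : IsProbabilityMeasure (gcond f n (gm κ x0 f n)) := by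
  constructor
  rw [gcond, Measure.smul_apply, withDensity_apply _ MeasurableSet.univ, setLIntegral_univ,
    smul_eq_mul]
  exact ENNReal.inv_mul_cancel h0 (ne_top_of_le_ne_top ENNReal.one_ne_top (gq_le hf hn))

lemma gm_prob (hκ : Measurable κ) (hf : GPol L f) : ∀ n ≤ L, (∀ i < n, gq κ x0 f i ≠ 0) →
    IsProbabilityMeasure (gm κ x0 f n)
  | 0, _, _ => by simp only [gm]; infer_instance
  | n + 1, h, h0 => by
    have h1 := gm_prob hκ hf n (by omega) (fun i hi => h0 i (by omega))
    have h2 := gcond_prob hf (by omega) h1 (h0 n (by omega))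
    constructor
    rw [gm, bind_univ hκ]
    exact h2.measure_univ

lemma withDensity_gm (hf : GPol L f) {n : ℕ} (hn : n < L)
    (h1 : IsProbabilityMeasure (gm κ x0 f n)) (h0 : gq κ x0 f n ≠ 0) :
    (gm κ x0 f n).withDensity (f n) = gq κ x0 f n • gcond f n (gm κ x0 f n) := by
  rw [gcond, smul_smul]
  change _ = (gq κ x0 f n * (gq κ x0 f n)⁻¹) • _
  rw [ENNReal.mul_inv_cancel h0 (ne_top_of_le_ne_top ENNReal.one_ne_top (gq_le hf hn)), one_smul]

lemma gU_eq (hκ : Measurable κ) (hf : GPol L f) : ∀ n ≤ L, (∀ i < n, gq κ x0 f i ≠ 0) →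
    gU κ x0 f n = (∏ i ∈ Finset.range n, gq κ x0 f i) • gm κ x0 f n
  | 0, _, _ => by simp [gm, gU]
  | n + 1, h, h0 => by
    have h1 := gm_prob hκ hf n (by omega) (fun i hi => h0 i (by omega))
    have ih := gU_eq hκ hf n (by omega) (fun i hi => h0 i (by omega))
    rw [gU, gm, ih, withDensity_smul_measure, withDensity_gm hf (by omega) h1 (h0 n (by omega)),
      Finset.prod_range_succ, smul_smul, Measure.bind_smul]

lemma gU_withDensity (hκ : Measurable κ) (hf : GPol L f) {n : ℕ} (hn : n < L)
    (h0 : ∀ i < L, gq κ x0 f i ≠ 0) :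
    (gU κ x0 f n).withDensity (f n)
      = (∏ i ∈ Finset.range (n + 1), gq κ x0 f i) • gcond f n (gm κ x0 f n) := by
  have h1 := gm_prob hκ hf n hn.le (fun i hi => h0 i (by omega))
  rw [gU_eq hκ hf n hn.le (fun i hi => h0 i (by omega)), withDensity_smul_measure,
    withDensity_gm hf hn h1 (h0 n hn), Finset.prod_range_succ, smul_smul]

lemma lintegral_gtm (hκ : Measurable κ) (hf : GPol L f) {n : ℕ} (hn : n < L)
    (h0 : ∀ i < L, gq κ x0 f i ≠ 0) (xh : ℕ → X) :
    ∫⁻ x, gtm c xh f n x ∂(gU κ x0 f n)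
      = (∏ i ∈ Finset.range (n + 1), gq κ x0 f i) *
          ∫⁻ x, ENNReal.ofReal (dist x (xh n) ^ 2) ∂(gcond f n (gm κ x0 f n))
        + ((∏ i ∈ Finset.range n, gq κ x0 f i) - ∏ i ∈ Finset.range (n + 1), gq κ x0 f i) * c n := by
  have hm := (hf n hn).1
  have h1 := gm_prob hκ hf n hn.le (fun i hi => h0 i (by omega))
  have e1 := gU_withDensity hκ hf hn h0
  have e2 := gU_eq hκ hf n hn.le (fun i hi => h0 i (by omega))
  unfold gtm
  rw [lintegral_add_left (f := fun x => f n x * ENNReal.ofReal (dist x (xh n) ^ 2))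
    (hm.mul (measurable_dsq _)), lintegral_mul_const (f := fun x => 1 - f n x) _
    (measurable_const.sub hm)]
  congr 1
  · have := lintegral_withDensity_eq_lintegral_mul (gU κ x0 f n) hm (measurable_dsq (xh n))
    rw [e1, lintegral_smul_measure] at this
    exact this.symm
  · congr 1
    have hfin : ∫⁻ x, f n x ∂(gU κ x0 f n) ≠ ∞ := by
      refine ne_top_of_le_ne_top ENNReal.one_ne_top ?_
      rw [← gU_univ_succ hκ]
      exact gU_univ_le hκ hf (n+1) hn
    rw [lintegral_sub hm hfin (Eventually.of_forall (hf n hn).2), ← gU_univ_succ hκ,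
      gU_eq hκ hf (n+1) hn (fun i hi => h0 i (by omega)), e2]
    have h2 := gm_prob hκ hf (n+1) hn (fun i hi => h0 i (by omega))
    simp

lemma gU_congr {f g : ℕ → X → ℝ≥0∞} : ∀ n, (∀ i < n, g i = f i) → gU κ x0 g n = gU κ x0 f n
  | 0, _ => rfl
  | n + 1, h => by
    rw [gU, gU, gU_congr n (fun i hi => h i (by omega)), h n (by omega)]

lemma gU_mono (hκ : Measurable κ) {f g : ℕ → X → ℝ≥0∞} (h : ∀ i x, g i x ≤ f i x) :
    ∀ n, gU κ x0 g n ≤ gU κ x0 f n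
  | 0 => le_rfl
  | n + 1 => by
    have ih := gU_mono hκ h n
    have h1 : (gU κ x0 g n).withDensity (g n) ≤ (gU κ x0 f n).withDensity (f n) := by
      rw [Measure.le_iff]
      intro s hs
      rw [withDensity_apply _ hs, withDensity_apply _ hs]
      exact lintegral_mono' (Measure.restrict_mono subset_rfl ih) (h n)
    rw [Measure.le_iff]
    intro s hs
    rw [gU, gU, Measure.bind_apply hs hκ.aemeasurable, Measure.bind_apply hs hκ.aemeasurable]
    exact lintegral_mono' h1 le_rfl

lemma gC_zero_lt (hκ : Measurable κ) (hc : ∀ n < L, c n ≠ ∞) (xh : ℕ → X) :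
    gC κ x0 c L xh (fun _ _ => 0) < ∞ := by
  have h0 : GPol L (fun (_ : ℕ) (_ : X) => (0 : ℝ≥0∞)) := fun n _ => ⟨measurable_const, by simp⟩
  unfold gC
  rw [ENNReal.sum_lt_top]
  intro n hn
  rw [Finset.mem_range] at hn
  have := gU_univ_le (x0 := x0) hκ h0 n hn.le
  simp only [gtm, zero_mul, tsub_zero, one_mul, zero_add, lintegral_const]
  exact ENNReal.mul_lt_top (hc n hn).lt_top (this.trans_lt ENNReal.one_lt_top)

lemma one_sub_mul_add {a b : ℝ≥0∞} (h : a ≤ 1) : a * b + (1 - a) * b = b := by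
  rw [← add_mul, add_tsub_cancel_of_le h, one_mul]

open Classical in
lemma opt_support (hκ : Measurable κ) (hf : GPol L f) (hc : ∀ n < L, c n ≠ ∞) {xh : ℕ → X}
    (hopt : ∀ g, GPol L g → gC κ x0 c L xh f ≤ gC κ x0 c L xh g) {n : ℕ} (hn : n < L) :
    ∀ᵐ x ∂(gU κ x0 f n), f n x ≠ 0 → ENNReal.ofReal (dist x (xh n) ^ 2) ≤ c n := by
  by_contra hcon
  set g : ℕ → X → ℝ≥0∞ := Function.update f n
    (fun x => if ENNReal.ofReal (dist x (xh n) ^ 2) ≤ c n then f n x else 0) with hg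
  have hfin : gC κ x0 c L xh f < ∞ :=
    (hopt _ (fun n _ => ⟨measurable_const, by simp⟩)).trans_lt (gC_zero_lt hκ hc xh)
  have gne : ∀ i, i ≠ n → g i = f i := fun i hi => by rw [hg, Function.update_of_ne hi]
  have gn : ∀ x, g n x = if ENNReal.ofReal (dist x (xh n) ^ 2) ≤ c n then f n x else 0 := by
    intro x; rw [hg, Function.update_self]
  have hgf : ∀ i x, g i x ≤ f i x := by
    intro i x
    by_cases hi : i = n
    · subst hi; rw [gn]; split_ifs <;> simp
    · rw [gne i hi]
  have hgP : GPol L g := by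
    intro i hi
    refine ⟨?_, fun x => (hgf i x).trans ((hf i hi).2 x)⟩
    by_cases h : i = n
    · subst h
      rw [hg, Function.update_self]
      exact Measurable.ite (measurableSet_le (measurable_dsq _) measurable_const) (hf i hi).1
        measurable_const
    · rw [gne i h]; exact (hf i hi).1
  have hUn : gU κ x0 g n = gU κ x0 f n := gU_congr n (fun i hi => gne i hi.ne)
  have hle : ∀ i, i ≠ n →
      ∫⁻ x, gtm c xh g i x ∂(gU κ x0 g i) ≤ ∫⁻ x, gtm c xh f i x ∂(gU κ x0 f i) := by
    intro i hi
    refine lintegral_mono' (gU_mono hκ hgf i) ?_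
    intro x; simp only [gtm, gne i hi]; exact le_rfl
  have hptle : ∀ x, gtm c xh g n x ≤ gtm c xh f n x := by
    intro x
    simp only [gtm, gn]
    split_ifs with h
    · exact le_rfl
    · simp only [zero_mul, tsub_zero, one_mul, zero_add]
      conv_lhs => rw [← one_sub_mul_add (b := c n) ((hf n hn).2 x)]
      gcongr
      exact (not_le.1 h).le
  have hlt : ∫⁻ x, gtm c xh g n x ∂(gU κ x0 g n) < ∫⁻ x, gtm c xh f n x ∂(gU κ x0 f n) := by
    rw [hUn]
    have hfn : ∫⁻ x, gtm c xh f n x ∂(gU κ x0 f n) ≠ ∞ := by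
      refine ne_top_of_le_ne_top hfin.ne ?_
      exact Finset.single_le_sum (f := fun n => ∫⁻ x, gtm c xh f n x ∂(gU κ x0 f n))
        (fun _ _ => zero_le) (Finset.mem_range.2 hn)
    refine lintegral_strict_mono_of_ae_le_of_ae_lt_on (measurable_gtm xh hf hn).aemeasurable
      (ne_top_of_le_ne_top hfn (lintegral_mono hptle)) (Eventually.of_forall hptle)
      (s := {x | ¬ (f n x ≠ 0 → ENNReal.ofReal (dist x (xh n) ^ 2) ≤ c n)}) ?_
      (Eventually.of_forall ?_)
    · rw [ae_iff] at hcon; exact hcon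
    · intro x hx
      simp only [Set.mem_ofPred_eq, not_forall] at hx
      obtain ⟨h0, h1⟩ := hx
      simp only [gtm, gn, if_neg h1, zero_mul, tsub_zero, one_mul, zero_add]
      conv_lhs => rw [← one_sub_mul_add (b := c n) ((hf n hn).2 x)]
      have hf1 : f n x ≠ ∞ := ne_top_of_le_ne_top ENNReal.one_ne_top ((hf n hn).2 x)
      refine ENNReal.add_lt_add_right (ENNReal.mul_ne_top (by simp) (hc n hn)) ?_
      exact ENNReal.mul_lt_mul_right h0 hf1 (not_le.1 h1)
  have : gC κ x0 c L xh g < gC κ x0 c L xh f := by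
    unfold gC
    rw [← Finset.add_sum_erase _ _ (Finset.mem_range.2 hn),
      ← Finset.add_sum_erase (Finset.range L) (fun n => ∫⁻ x, gtm c xh f n x ∂(gU κ x0 f n))
        (Finset.mem_range.2 hn)]
    have hrest : ∑ i ∈ (Finset.range L).erase n, ∫⁻ x, gtm c xh g i x ∂(gU κ x0 g i)
        ≤ ∑ i ∈ (Finset.range L).erase n, ∫⁻ x, gtm c xh f i x ∂(gU κ x0 f i) :=
      Finset.sum_le_sum fun i hi => hle i (Finset.ne_of_mem_erase hi)
    refine ENNReal.add_lt_add_of_lt_of_le ?_ hlt hrest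
    refine ne_top_of_le_ne_top hfin.ne (hrest.trans ?_)
    exact Finset.sum_le_sum_of_subset (Finset.erase_subset _ _)
  exact absurd (hopt g hgP) (not_le.2 this)

lemma exists_ball_compl (μ : Measure X) [IsFiniteMeasure μ] (x0 : X) {δ : ℝ≥0∞} (hδ : 0 < δ) :
    ∃ R : ℝ, μ (Metric.closedBall x0 R)ᶜ < δ := by
  have h : Tendsto (fun n : ℕ => μ (Metric.closedBall x0 (n : ℝ))ᶜ) atTop
      (𝓝 (μ (⋂ n : ℕ, (Metric.closedBall x0 (n : ℝ))ᶜ))) := by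
    apply tendsto_measure_iInter_atTop
    · intro n; exact Metric.isClosed_closedBall.measurableSet.compl.nullMeasurableSet
    · intro a b hab
      exact Set.compl_subset_compl.2 (Metric.closedBall_subset_closedBall (by exact_mod_cast hab))
    · exact ⟨0, measure_ne_top _ _⟩
  rw [← Set.compl_iUnion, Metric.iUnion_closedBall_nat, Set.compl_univ, measure_empty] at h
  obtain ⟨n, hn⟩ := (h.eventually (gt_mem_nhds hδ)).exists
  exact ⟨n, hn⟩

lemma unif_tight (hcont : ∀ A, MeasurableSet A → Continuous fun x => κ x A) {K : Set X}
    (hK : IsCompact K) (x0 : X) {δ : ℝ≥0∞} (hδ : 0 < δ) :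
    ∃ R : ℝ, ∀ x ∈ K, κ x (Metric.closedBall x0 R)ᶜ ≤ δ := by
  refine hK.induction_on (p := fun s => ∃ R : ℝ, ∀ x ∈ s, κ x (Metric.closedBall x0 R)ᶜ ≤ δ)
    ⟨0, by simp⟩ ?_ ?_ ?_
  · rintro s t hst ⟨R, hR⟩; exact ⟨R, fun x hx => hR x (hst hx)⟩
  · rintro s t ⟨R, hR⟩ ⟨R', hR'⟩
    refine ⟨max R R', ?_⟩
    rintro x (hx | hx)
    · exact (measure_mono (Set.compl_subset_compl.2
        (Metric.closedBall_subset_closedBall (le_max_left _ _)))).trans (hR x hx)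
    · exact (measure_mono (Set.compl_subset_compl.2
        (Metric.closedBall_subset_closedBall (le_max_right _ _)))).trans (hR' x hx)
  · intro x hx
    obtain ⟨R, hR⟩ := exists_ball_compl (κ x) x0 hδ
    refine ⟨{y | κ y (Metric.closedBall x0 R)ᶜ < δ}, mem_nhdsWithin_of_mem_nhds ?_, R,
      fun y hy => le_of_lt hy⟩
    exact (hcont _ Metric.isClosed_closedBall.measurableSet.compl).continuousAt.eventually
      (gt_mem_nhds hR)

variable {ι : Type*} {F : ι → ℕ → X → ℝ≥0∞} {xs : ι → ℕ → X} {ε : ℝ≥0∞}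

lemma mass_ge (hκ : Measurable κ) (hf : GPol L f) (hε : 0 < ε)
    (hq : ∀ n < L, ε ≤ gq κ x0 f n) {n : ℕ} (hn : n < L) :
    ε ^ (n + 1) ≤ ∫⁻ x, f n x ∂(gU κ x0 f n) := by
  have h0 : ∀ i < L, gq κ x0 f i ≠ 0 := fun i hi => (hε.trans_le (hq i hi)).ne'
  have h2 := gm_prob hκ hf (n+1) hn (fun i hi => h0 i (by omega))
  rw [← gU_univ_succ hκ, gU_eq hκ hf (n+1) hn (fun i hi => h0 i (by omega))]
  simp only [Measure.smul_apply, measure_univ, smul_eq_mul, mul_one]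
  calc ε ^ (n+1) = ∏ i ∈ Finset.range (n+1), ε := by simp
    _ ≤ _ := Finset.prod_le_prod' fun i hi => hq i (by rw [Finset.mem_range] at hi; omega)

lemma bdd_step (hκ : Measurable κ) (hF : ∀ i, GPol L (F i)) (hc : ∀ n < L, c n ≠ ∞)
    (hopt : ∀ i g, GPol L g → gC κ x0 c L (xs i) (F i) ≤ gC κ x0 c L (xs i) g)
    (hε : 0 < ε) (hq : ∀ i, ∀ n < L, ε ≤ gq κ x0 (F i) n) {n : ℕ} (hn : n < L)
    (ht : ∀ δ : ℝ≥0∞, 0 < δ → ∃ R : ℝ, ∀ i, gU κ x0 (F i) n (Metric.closedBall x0 R)ᶜ < δ) :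
    ∃ R : ℝ, ∀ i, dist (xs i n) x0 ≤ R ∧
      ∀ᵐ x ∂(gU κ x0 (F i) n), F i n x ≠ 0 → dist x x0 ≤ R := by
  obtain ⟨R, hR⟩ := ht (ε ^ (n+1)) (ENNReal.pow_pos hε _)
  set r := Real.sqrt (c n).toReal with hr
  have hr0 : 0 ≤ r := Real.sqrt_nonneg _
  have hsup : ∀ i, ∀ᵐ x ∂(gU κ x0 (F i) n), F i n x ≠ 0 → dist x (xs i n) ≤ r := by
    intro i
    filter_upwards [opt_support hκ (hF i) hc (hopt i) hn] with x hx h0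
    refine Real.le_sqrt_of_sq_le ?_
    exact (ENNReal.ofReal_le_iff_le_toReal (hc n hn)).1 (hx h0)
  have hb : ∀ i, dist (xs i n) x0 ≤ R + r := by
    intro i
    by_contra hcon
    push Not at hcon
    have : ∫⁻ x, F i n x ∂(gU κ x0 (F i) n)
        ≤ gU κ x0 (F i) n (Metric.closedBall x0 R)ᶜ := by
      rw [← lintegral_indicator_one Metric.isClosed_closedBall.measurableSet.compl]
      apply lintegral_mono_ae
      filter_upwards [hsup i] with x hx
      by_cases h0 : F i n x = 0
      · rw [h0]; exact zero_le
      · have hxx : x ∈ (Metric.closedBall x0 R)ᶜ := by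
          simp only [Set.mem_compl_iff, Metric.mem_closedBall, not_le]
          have := dist_triangle (xs i n) x x0
          rw [dist_comm _ x] at this
          have := hx h0
          linarith
        rw [Set.indicator_of_mem hxx]
        exact (hF i n hn).2 x
    exact absurd (mass_ge hκ (hF i) hε (hq i) hn) (not_le.2 (this.trans_lt (hR i)))
  refine ⟨R + r + r, fun i => ⟨by linarith [hb i], ?_⟩⟩
  filter_upwards [hsup i] with x hx h0
  linarith [hx h0, hb i, dist_triangle x (xs i n) x0]

lemma tight_all (hκ : Measurable κ) (hcont : ∀ A, MeasurableSet A → Continuous fun x => κ x A)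
    (hF : ∀ i, GPol L (F i)) (hc : ∀ n < L, c n ≠ ∞)
    (hopt : ∀ i g, GPol L g → gC κ x0 c L (xs i) (F i) ≤ gC κ x0 c L (xs i) g)
    (hε : 0 < ε) (hq : ∀ i, ∀ n < L, ε ≤ gq κ x0 (F i) n) : ∀ n < L,
    ∀ δ : ℝ≥0∞, 0 < δ → ∃ R : ℝ, ∀ i, gU κ x0 (F i) n (Metric.closedBall x0 R)ᶜ < δ
  | 0, _, δ, hδ => by
    obtain ⟨R, hR⟩ := exists_ball_compl (κ x0) x0 hδ
    exact ⟨R, fun i => hR⟩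
  | n + 1, hn, δ, hδ => by
    obtain ⟨R, hR⟩ := bdd_step hκ hF hc hopt hε hq (n := n) (by omega)
      (tight_all hκ hcont hF hc hopt hε hq n (by omega))
    obtain ⟨δ', hδ', hδδ⟩ := exists_between hδ
    obtain ⟨R', hR'⟩ := unif_tight hcont (isCompact_closedBall x0 R) x0 hδ'
    refine ⟨R', fun i => lt_of_le_of_lt ?_ hδδ⟩
    have hms := (Metric.isClosed_closedBall (x := x0) (ε := R')).measurableSet.compl
    have hm := (hF i n (by omega)).1
    have hmk : Measurable fun a => κ a (Metric.closedBall x0 R')ᶜ :=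
      (Measure.measurable_coe hms).comp hκ
    rw [gU, Measure.bind_apply hms hκ.aemeasurable,
      lintegral_withDensity_eq_lintegral_mul _ hm hmk]
    calc _ ≤ ∫⁻ x, δ' ∂(gU κ x0 (F i) n) := by
          apply lintegral_mono_ae
          filter_upwards [(hR i).2] with x hx
          simp only [Pi.mul_apply]
          by_cases h0 : F i n x = 0
          · rw [h0, zero_mul]; exact zero_le
          · exact (mul_le_mul' ((hF i n (by omega)).2 x)
              (hR' x (Metric.mem_closedBall.2 (hx h0)))).trans (one_mul _).le
      _ ≤ δ' := by
          rw [lintegral_const]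
          exact (mul_le_mul' le_rfl (gU_univ_le hκ (hF i) n (by omega))).trans (mul_one _).le

lemma bdd_all (hκ : Measurable κ) (hcont : ∀ A, MeasurableSet A → Continuous fun x => κ x A)
    (hF : ∀ i, GPol L (F i)) (hc : ∀ n < L, c n ≠ ∞)
    (hopt : ∀ i g, GPol L g → gC κ x0 c L (xs i) (F i) ≤ gC κ x0 c L (xs i) g)
    (hε : 0 < ε) (hq : ∀ i, ∀ n < L, ε ≤ gq κ x0 (F i) n) : 
    ∃ R : ℝ, ∀ n < L, ∀ i, dist (xs i n) x0 ≤ R ∧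
      ∀ᵐ x ∂(gcond (F i) n (gm κ x0 (F i) n)), dist x x0 ≤ R := by
  have h : ∀ n : ℕ, ∃ R : ℝ, n < L → ∀ i, dist (xs i n) x0 ≤ R ∧
      ∀ᵐ x ∂(gcond (F i) n (gm κ x0 (F i) n)), dist x x0 ≤ R := by
    intro n
    by_cases hn : n < L
    · obtain ⟨R, hR⟩ := bdd_step hκ hF hc hopt hε hq hn
        (tight_all hκ hcont hF hc hopt hε hq n hn)
      refine ⟨R, fun _ i => ⟨(hR i).1, ?_⟩⟩
      have h0 : ∀ j < L, gq κ x0 (F i) j ≠ 0 := fun j hj => (hε.trans_le (hq i j hj)).ne'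
      have hP : (∏ j ∈ Finset.range (n + 1), gq κ x0 (F i) j) ≠ 0 := by
        rw [Finset.prod_ne_zero_iff]
        intro j hj; rw [Finset.mem_range] at hj; exact h0 j (by omega)
      have e := gU_withDensity hκ (hF i) hn h0
      have h3 : ∀ᵐ x ∂((gU κ x0 (F i) n).withDensity (F i n)), dist x x0 ≤ R := by
        rw [ae_withDensity_iff (hF i n hn).1]; exact (hR i).2
      rw [e] at h3
      exact (Measure.ae_ennreal_smul_measure_iff hP).1 h3
    · exact ⟨0, fun h => absurd h hn⟩
  choose R hR using h
  obtain ⟨B, hB⟩ := ((Finset.range L).image R).bddAbove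
  refine ⟨B, fun n hn i => ?_⟩
  have : R n ≤ B := hB (by simpa using ⟨n, hn, rfl⟩)
  refine ⟨(hR n hn i).1.trans this, ?_⟩
  filter_upwards [(hR n hn i).2] with x hx using hx.trans this

def GWeak (μl : ℕ → Measure X) (μ : Measure X) : Prop :=
  ∀ h : X → ℝ, Continuous h → (∃ C : ℝ, ∀ x, |h x| ≤ C) →
    Tendsto (fun l => ∫ x, h x ∂(μl l)) atTop (𝓝 (∫ x, h x ∂μ))

lemma gweak_iff (p : ℕ → ProbabilityMeasure X) (μ : ProbabilityMeasure X) :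
    Tendsto p atTop (𝓝 μ) ↔ GWeak (fun l => (p l : Measure X)) (μ : Measure X) := by
  rw [ProbabilityMeasure.tendsto_iff_forall_integral_tendsto]
  constructor
  · rintro H h hh ⟨C, hC⟩
    exact H (BoundedContinuousFunction.ofNormedAddCommGroup h hh C hC)
  · intro H h
    exact H h h.continuous ⟨‖h‖, fun x => h.norm_coe_le_norm x⟩

lemma bind_tendsto (hκ : Measurable κ) (hcont : ∀ A, MeasurableSet A → Continuous fun x => κ x A)
    {p : ℕ → ProbabilityMeasure X} {μ : ProbabilityMeasure X} (h : Tendsto p atTop (𝓝 μ))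
    {A : Set X} (hA : MeasurableSet A) :
    Tendsto (fun l => ((p l : Measure X).bind κ) A) atTop (𝓝 (((μ : Measure X).bind κ) A)) := by
  rw [ProbabilityMeasure.tendsto_iff_forall_lintegral_tendsto] at h
  have hc : Continuous fun x => (κ x A).toNNReal := by
    rw [continuous_iff_continuousAt]
    intro x
    exact (ENNReal.tendsto_toNNReal (measure_ne_top _ _)).comp (hcont A hA).continuousAt
  have hb : ∀ x y, dist ((κ x A).toNNReal) ((κ y A).toNNReal) ≤ 1 := by
    intro x y
    rw [NNReal.dist_eq]
    have h1 : ∀ x, ((κ x A).toNNReal : ℝ) ≤ 1 := by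
      intro x
      have : (κ x A).toNNReal ≤ 1 := by
        have := ENNReal.toNNReal_mono ENNReal.one_ne_top (prob_le_one (μ := κ x) (s := A))
        simpa using this
      exact_mod_cast this
    rw [abs_le]
    constructor <;> linarith [h1 x, h1 y, (κ x A).toNNReal.coe_nonneg, (κ y A).toNNReal.coe_nonneg]
  have := h (BoundedContinuousFunction.mkOfBound ⟨fun x => (κ x A).toNNReal, hc⟩ 1 hb)
  simp only [BoundedContinuousFunction.mkOfBound_coe, ContinuousMap.coe_mk] at this
  simp only [ENNReal.coe_toNNReal (measure_ne_top _ _)] at this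
  simpa only [Measure.bind_apply hA hκ.aemeasurable] using this

lemma le_of_open {μ ν : Measure X} [IsFiniteMeasure ν] (h : ∀ G, IsOpen G → μ G ≤ ν G) :
    μ ≤ ν := by
  intro A
  rw [Set.measure_eq_iInf_isOpen A ν]
  refine le_iInf fun U => le_iInf fun hU => le_iInf fun hUo => ?_
  exact (measure_mono hU).trans (h U hUo)

/-- predicted measure built from conditional ones -/
def gpred (κ : X → Measure X) (x0 : X) (M : ℕ → Measure X) : ℕ → Measure X
  | 0 => κ x0
  | n + 1 => (M n).bind κ

lemma build_policy (hκ : Measurable κ) (M : ℕ → Measure X) (q : ℕ → ℝ≥0∞)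
    (hM : ∀ n < L, IsProbabilityMeasure (M n)) (hq0 : ∀ n < L, q n ≠ 0) (hq1 : ∀ n < L, q n ≤ 1)
    (hle : ∀ n < L, q n • M n ≤ gpred κ x0 M n) :
    ∃ f : ℕ → X → ℝ≥0∞, GPol L f ∧ ∀ n < L, gq κ x0 f n = q n ∧
      gcond f n (gm κ x0 f n) = M n := by
  let f : ℕ → X → ℝ≥0∞ := fun n x => min 1 ((q n • M n).rnDeriv (gpred κ x0 M n) x)
  have key : ∀ n < L, gm κ x0 f n = gpred κ x0 M n →
      gq κ x0 f n = q n ∧ gcond f n (gm κ x0 f n) = M n := by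
    intro n hn e
    have hMn := hM n hn
    have hfin : IsFiniteMeasure (gpred κ x0 M n) := by
      cases n with
      | zero => simp only [gpred]; infer_instance
      | succ n =>
        have := hM n (by omega)
        constructor
        rw [gpred, bind_univ hκ]; exact measure_lt_top _ _
    have hqt : q n ≠ ∞ := ne_top_of_le_ne_top ENNReal.one_ne_top (hq1 n hn)
    have hfq : IsFiniteMeasure (q n • M n) := Measure.smul_finite _ hqt
    have hw : (gpred κ x0 M n).withDensity (f n) = q n • M n := by
      have h1 : f n =ᵐ[gpred κ x0 M n] (q n • M n).rnDeriv (gpred κ x0 M n) := by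
        filter_upwards [Measure.rnDeriv_le_one_of_le (hle n hn)] with x hx
        exact min_eq_right hx
      rw [withDensity_congr_ae h1, Measure.withDensity_rnDeriv_eq _ _
        (Measure.absolutelyContinuous_of_le (hle n hn))]
    have hq : ∫⁻ x, f n x ∂(gpred κ x0 M n) = q n := by
      rw [← setLIntegral_univ, ← withDensity_apply _ MeasurableSet.univ, hw]
      simp
    refine ⟨by rw [gq, e, hq], ?_⟩
    rw [gcond, e, hq, hw, smul_smul, ENNReal.inv_mul_cancel (hq0 n hn) hqt, one_smul]
  have hg : ∀ n < L, gm κ x0 f n = gpred κ x0 M n := by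
    intro n
    induction n with
    | zero => intro _; rfl
    | succ n ih =>
      intro hn
      rw [gm, (key n (by omega) (ih (by omega))).2]
      rfl
  refine ⟨f, fun n _ => ⟨?_, fun x => min_le_left _ _⟩, fun n hn => key n hn (hg n hn)⟩
  exact measurable_const.min (Measure.measurable_rnDeriv _ _)

lemma isCompact_supp (x0 : X) (R : ℝ) :
    IsCompact (closure {μ : ProbabilityMeasure X | ∀ᵐ x ∂(μ : Measure X), dist x x0 ≤ R}) := by
  apply isCompact_closure_of_isTightMeasureSet
  rw [isTightMeasureSet_iff_exists_isCompact_measure_compl_le]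
  intro δ hδ
  refine ⟨Metric.closedBall x0 R, isCompact_closedBall _ _, ?_⟩
  rintro _ ⟨μ, hμ, rfl⟩
  have : (μ : Measure X) (Metric.closedBall x0 R)ᶜ = 0 := by
    have h : ∀ᵐ x ∂(μ : Measure X), dist x x0 ≤ R := hμ
    rw [ae_iff] at h
    exact h
  rw [this]; exact zero_le

theorem gen_partA {F : ℕ → ℕ → X → ℝ≥0∞} {ys : ℕ → ℕ → X}
    (hκ : Measurable κ) (hcont : ∀ A, MeasurableSet A → Continuous fun x => κ x A)
    (hF : ∀ i, GPol L (F i)) (hε : 0 < ε) (hq : ∀ i, ∀ n < L, ε ≤ gq κ x0 (F i) n) {R : ℝ}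
    (hR : ∀ n < L, ∀ i, dist (ys i n) x0 ≤ R ∧
      ∀ᵐ x ∂(gcond (F i) n (gm κ x0 (F i) n)), dist x x0 ≤ R) :
    ∃ φ : ℕ → ℕ, StrictMono φ ∧ ∃ (f : ℕ → X → ℝ≥0∞) (xh : ℕ → X),
      GPol L f ∧ (∀ n < L, gq κ x0 f n ≠ 0) ∧
      (∀ n < L, GWeak (fun l => gcond (F (φ l)) n (gm κ x0 (F (φ l)) n))
          (gcond f n (gm κ x0 f n)) ∧
        Tendsto (fun l => gq κ x0 (F (φ l)) n) atTop (𝓝 (gq κ x0 f n)) ∧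
        Tendsto (fun l => ys (φ l) n) atTop (𝓝 (xh n))) := by
  have h0 : ∀ i, ∀ j < L, gq κ x0 (F i) j ≠ 0 := fun i j hj => (hε.trans_le (hq i j hj)).ne'
  have hmp : ∀ i, ∀ n < L, IsProbabilityMeasure (gm κ x0 (F i) n) := fun i n hn =>
    gm_prob hκ (hF i) n hn.le (fun j hj => h0 i j (by omega))
  have hcp : ∀ i, ∀ n < L, IsProbabilityMeasure (gcond (F i) n (gm κ x0 (F i) n)) :=
    fun i n hn => gcond_prob (hF i) hn (hmp i n hn) (h0 i n hn)
  have hql : ∀ i, ∀ n < L, gq κ x0 (F i) n ≤ 1 := fun i n hn => by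
    have := hmp i n hn
    exact gq_le (hF i) hn
  let s : ℕ → Fin L → ProbabilityMeasure X × ℝ≥0∞ × X := fun i n =>
    (⟨_, hcp i n n.2⟩, gq κ x0 (F i) n, ys i n)
  let K : Set (Fin L → ProbabilityMeasure X × ℝ≥0∞ × X) := Set.pi Set.univ fun _ =>
    closure {μ : ProbabilityMeasure X | ∀ᵐ x ∂(μ : Measure X), dist x x0 ≤ R} ×ˢ
      (Set.Icc ε 1 ×ˢ Metric.closedBall x0 R)
  have hK : IsCompact K := isCompact_univ_pi fun _ =>
    (isCompact_supp x0 R).prod (isCompact_Icc.prod (isCompact_closedBall _ _))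
  have hs : ∀ i, s i ∈ K := by
    intro i n _
    exact ⟨subset_closure (hR n n.2 i).2, ⟨hq i n n.2, hql i n n.2⟩,
      Metric.mem_closedBall.2 (hR n n.2 i).1⟩
  obtain ⟨a, haK, φ, hφ, hlim⟩ := hK.tendsto_subseq hs
  rw [tendsto_pi_nhds] at hlim
  have hl1 : ∀ n : Fin L, Tendsto (β := ProbabilityMeasure X) (fun l => ⟨_, hcp (φ l) n n.2⟩) atTop
      (𝓝 (a n).1) := fun n => ((continuous_fst.tendsto _).comp (hlim n))
  have hl2 : ∀ n : Fin L, Tendsto (fun l => gq κ x0 (F (φ l)) n) atTop (𝓝 (a n).2.1) :=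
    fun n => (((continuous_fst.comp continuous_snd).tendsto _).comp (hlim n))
  have hl3 : ∀ n : Fin L, Tendsto (fun l => ys (φ l) n) atTop (𝓝 (a n).2.2) :=
    fun n => (((continuous_snd.comp continuous_snd).tendsto _).comp (hlim n))
  let M : ℕ → Measure X := fun n => if h : n < L then ((a ⟨n, h⟩).1 : Measure X) else 0
  let q : ℕ → ℝ≥0∞ := fun n => if h : n < L then (a ⟨n, h⟩).2.1 else 0
  let xh : ℕ → X := fun n => if h : n < L then (a ⟨n, h⟩).2.2 else x0
  have eM : ∀ n (h : n < L), M n = ((a ⟨n, h⟩).1 : Measure X) := fun n h => dif_pos h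
  have eq : ∀ n (h : n < L), q n = (a ⟨n, h⟩).2.1 := fun n h => dif_pos h
  have ex : ∀ n (h : n < L), xh n = (a ⟨n, h⟩).2.2 := fun n h => dif_pos h
  have hqI : ∀ n < L, ε ≤ q n ∧ q n ≤ 1 := fun n h => by
    rw [eq n h]; exact (haK ⟨n, h⟩ trivial).2.1
  have hMp : ∀ n < L, IsProbabilityMeasure (M n) := fun n h => by
    rw [eM n h]; infer_instance
  have hq0 : ∀ n < L, q n ≠ 0 := fun n h => (hε.trans_le (hqI n h).1).ne'
  have hqt : ∀ n < L, q n ≠ ∞ := fun n h => ne_top_of_le_ne_top ENNReal.one_ne_top (hqI n h).2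
  have hpf : ∀ n < L, IsFiniteMeasure (gpred κ x0 M n) := by
    intro n hn
    cases n with
    | zero => simp only [gpred]; infer_instance
    | succ n =>
      have := hMp n (by omega)
      constructor
      rw [gpred, bind_univ hκ]; exact measure_lt_top _ _
  have hpred : ∀ n < L, ∀ A, MeasurableSet A → Tendsto (fun l => gm κ x0 (F (φ l)) n A) atTop
      (𝓝 (gpred κ x0 M n A)) := by
    intro n hn A hA
    cases n with
    | zero => simp only [gm, gpred]; exact tendsto_const_nhds
    | succ n =>
      simp only [gm, gpred, eM n (by omega)]
      exact bind_tendsto hκ hcont (hl1 ⟨n, by omega⟩) hA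
  have hle : ∀ n < L, q n • M n ≤ gpred κ x0 M n := by
    intro n hn
    have := hpf n hn
    refine le_of_open fun G hG => ?_
    have h1 : M n G ≤ (q n)⁻¹ * gpred κ x0 M n G := by
      rw [eM n hn]
      refine (ProbabilityMeasure.le_liminf_measure_open_of_tendsto (hl1 ⟨n, hn⟩) hG).trans ?_
      have ht : Tendsto (fun l => (gq κ x0 (F (φ l)) n)⁻¹ * gm κ x0 (F (φ l)) n G) atTop
          (𝓝 ((q n)⁻¹ * gpred κ x0 M n G)) := by
        refine ENNReal.Tendsto.mul ?_ (Or.inr (measure_ne_top _ _))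
          (hpred n hn G hG.measurableSet) (Or.inr (ENNReal.inv_ne_top.2 (hq0 n hn)))
        rw [eq n hn]
        exact tendsto_inv_iff.2 (hl2 ⟨n, hn⟩)
      rw [← ht.liminf_eq]
      refine liminf_le_liminf (Eventually.of_forall fun l => ?_)
      change gcond (F (φ l)) n (gm κ x0 (F (φ l)) n) G ≤ _
      rw [gcond, Measure.smul_apply, smul_eq_mul]
      refine mul_le_mul' le_rfl ?_
      rw [withDensity_apply _ hG.measurableSet]
      refine (lintegral_mono fun x => (hF (φ l) n hn).2 x).trans ?_
      simp
    rw [Measure.smul_apply, smul_eq_mul]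
    refine (mul_le_mul' le_rfl h1).trans ?_
    rw [← mul_assoc, ENNReal.mul_inv_cancel (hq0 n hn) (hqt n hn), one_mul]
  obtain ⟨f, hf, hfe⟩ := build_policy (x0 := x0) hκ M q hMp hq0 (fun n h => (hqI n h).2) hle
  refine ⟨φ, hφ, f, xh, hf, fun n hn => by rw [(hfe n hn).1]; exact hq0 n hn, fun n hn => ?_⟩
  rw [(hfe n hn).1, (hfe n hn).2, eM n hn, eq n hn, ex n hn]
  exact ⟨(gweak_iff _ _).1 (hl1 ⟨n, hn⟩), hl2 ⟨n, hn⟩, hl3 ⟨n, hn⟩⟩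

lemma conv_moment {p : ℕ → Measure X} {μ : Measure X} [∀ l, IsProbabilityMeasure (p l)]
    [IsProbabilityMeasure μ] (hw : GWeak p μ) {R : ℝ}
    (hR : ∀ l, ∀ᵐ x ∂(p l), dist x x0 ≤ R) {y : ℕ → X} {z : X} (hy : Tendsto y atTop (𝓝 z)) :
    Tendsto (fun l => ∫⁻ x, ENNReal.ofReal (dist x (y l) ^ 2) ∂(p l)) atTop
      (𝓝 (∫⁻ x, ENNReal.ofReal (dist x z ^ 2) ∂μ)) ∧
      ∫⁻ x, ENNReal.ofReal (dist x z ^ 2) ∂μ ≠ ∞ := by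
  have hμR : ∀ᵐ x ∂μ, dist x x0 ≤ R := by
    have hw' : Tendsto (β := ProbabilityMeasure X) (fun l => ⟨p l, inferInstance⟩) atTop
        (𝓝 ⟨μ, inferInstance⟩) := (gweak_iff _ _).2 hw
    have hG : IsOpen {x : X | ¬ dist x x0 ≤ R} := by
      simp only [not_le]
      exact isOpen_lt continuous_const (continuous_id.dist continuous_const)
    have := ProbabilityMeasure.le_liminf_measure_open_of_tendsto hw' hG
    rw [ae_iff]
    refine le_antisymm (le_trans this ?_) zero_le
    have h0 : ∀ l, p l {x : X | ¬ dist x x0 ≤ R} = 0 := fun l => (ae_iff.1 (hR l))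
    change liminf (fun l => p l {x : X | ¬ dist x x0 ≤ R}) atTop ≤ 0
    rw [show (fun l => p l {x : X | ¬ dist x x0 ≤ R}) = fun _ => 0 from funext h0]
    simp
  set B : ℝ := |R| + dist x0 z + 1 with hB
  have hB0 : 0 ≤ B := by positivity
  have hRR := le_abs_self R
  let h : X → X → ℝ := fun w x => (min (dist x w) B) ^ 2
  have h_nn : ∀ w x : X, 0 ≤ h w x := fun w x => sq_nonneg _
  have hm0 : ∀ w x : X, 0 ≤ min (dist x w) B := fun w x => le_min dist_nonneg hB0
  have h_le : ∀ w x : X, h w x ≤ B ^ 2 := fun w x =>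
    pow_le_pow_left₀ (hm0 w x) (min_le_right _ _) 2
  have h_cont : ∀ w, Continuous (h w) := fun w => by fun_prop
  have h_int : ∀ w (ν : Measure X) [IsProbabilityMeasure ν], Integrable (h w) ν := by
    intro w ν _
    refine Integrable.of_bound (h_cont w).measurable.aestronglyMeasurable (B ^ 2)
      (Eventually.of_forall fun x => ?_)
    rw [Real.norm_eq_abs, abs_of_nonneg (h_nn w x)]; exact h_le w x
  have h_lip : ∀ w w' x, |h w x - h w' x| ≤ 2 * B * dist w w' := by
    intro w w' x
    have e : h w x - h w' x = (min (dist x w) B + min (dist x w') B)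
        * (min (dist x w) B - min (dist x w') B) := by simp only [h]; ring
    rw [e, abs_mul, abs_of_nonneg (add_nonneg (hm0 w x) (hm0 w' x))]
    refine mul_le_mul (by linarith [min_le_right (dist x w) B, min_le_right (dist x w') B]) ?_
      (abs_nonneg _) (by positivity)
    refine (abs_min_sub_min_le_max _ _ _ _).trans ?_
    simp only [sub_self, abs_zero]
    refine max_le ?_ dist_nonneg
    have := abs_dist_sub_le w w' x
    rwa [dist_comm w x, dist_comm w' x] at this
  have h_eq : ∀ w (ν : Measure X) [IsProbabilityMeasure ν], dist w z ≤ 1 →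
      (∀ᵐ x ∂ν, dist x x0 ≤ R) →
      ∫⁻ x, ENNReal.ofReal (dist x w ^ 2) ∂ν = ENNReal.ofReal (∫ x, h w x ∂ν) := by
    intro w ν _ hw hν
    rw [ofReal_integral_eq_lintegral_ofReal (h_int w ν) (Eventually.of_forall (h_nn w))]
    apply lintegral_congr_ae
    filter_upwards [hν] with x hx
    have : dist x w ≤ B := by
      have h1 := dist_triangle x x0 w
      have h2 := dist_triangle x0 z w
      rw [dist_comm z w] at h2
      linarith
    simp only [h, min_eq_left this]
  have hz := h_eq z μ (by simp) hμR
  refine ⟨?_, by rw [hz]; exact ENNReal.ofReal_ne_top⟩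
  rw [hz]
  have hev : ∀ᶠ l in atTop, dist (y l) z ≤ 1 := by
    filter_upwards [Metric.tendsto_nhds.1 hy 1 one_pos] with l hl using hl.le
  have hreal : Tendsto (fun l => ∫ x, h (y l) x ∂(p l)) atTop (𝓝 (∫ x, h z x ∂μ)) := by
    have h1 := hw (h z) (h_cont z) ⟨B ^ 2, fun x => by
      rw [abs_of_nonneg (h_nn z x)]; exact h_le z x⟩
    have h2 : Tendsto (fun l => ∫ x, h (y l) x ∂(p l) - ∫ x, h z x ∂(p l)) atTop (𝓝 0) := by
      refine squeeze_zero_norm (a := fun l => 2 * B * dist (y l) z) (fun l => ?_) ?_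
      · rw [← integral_sub (h_int _ _) (h_int _ _)]
        have := norm_integral_le_of_norm_le_const (μ := p l)
          (f := fun x => h (y l) x - h z x) (C := 2 * B * dist (y l) z)
          (Eventually.of_forall fun x => h_lip (y l) z x)
        simpa using this
      · have := (tendsto_iff_dist_tendsto_zero.1 hy).const_mul (2 * B)
        simpa using this
    have := h2.add h1
    simpa using this
  refine (ENNReal.tendsto_ofReal hreal).congr' ?_
  filter_upwards [hev] with l hl
  exact (h_eq (y l) (p l) hl (hR l)).symm

lemma conv_cost {F : ℕ → ℕ → X → ℝ≥0∞}
    (hκ : Measurable κ) (hc : ∀ n < L, c n ≠ ∞) (hF : ∀ i, GPol L (F i)) (hf : GPol L f)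
    (hF0 : ∀ i, ∀ n < L, gq κ x0 (F i) n ≠ 0) (hf0 : ∀ n < L, gq κ x0 f n ≠ 0) {R : ℝ}
    (hR : ∀ n < L, ∀ i, ∀ᵐ x ∂(gcond (F i) n (gm κ x0 (F i) n)), dist x x0 ≤ R)
    (hw : ∀ n < L, GWeak (fun l => gcond (F l) n (gm κ x0 (F l) n)) (gcond f n (gm κ x0 f n)))
    (hq : ∀ n < L, Tendsto (fun l => gq κ x0 (F l) n) atTop (𝓝 (gq κ x0 f n)))
    {y : ℕ → ℕ → X} {z : ℕ → X} (hy : ∀ n < L, Tendsto (fun l => y l n) atTop (𝓝 (z n))) :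
    Tendsto (fun l => gC κ x0 c L (y l) (F l)) atTop (𝓝 (gC κ x0 c L z f)) := by
  unfold gC
  refine tendsto_finsetSum _ fun n hn => ?_
  rw [Finset.mem_range] at hn
  have hmp : ∀ g : ℕ → X → ℝ≥0∞, GPol L g → (∀ n < L, gq κ x0 g n ≠ 0) → ∀ n < L,
      IsProbabilityMeasure (gm κ x0 g n) := fun g hg h0 n hn =>
    gm_prob hκ hg n hn.le (fun j hj => h0 j (by omega))
  have i1 : ∀ l, IsProbabilityMeasure (gcond (F l) n (gm κ x0 (F l) n)) := fun l =>
    gcond_prob (hF l) hn (hmp _ (hF l) (hF0 l) n hn) (hF0 l n hn)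
  have i2 : IsProbabilityMeasure (gcond f n (gm κ x0 f n)) :=
    gcond_prob hf hn (hmp _ hf hf0 n hn) (hf0 n hn)
  obtain ⟨hm, hmt⟩ := conv_moment (hw n hn) (hR n hn) (hy n hn)
  have hq1 : ∀ i < L, gq κ x0 f i ≤ 1 := fun i hi => by
    have := hmp f hf hf0 i hi
    exact gq_le hf hi
  have hP : ∀ m ≤ L, (∏ i ∈ Finset.range m, gq κ x0 f i) ≠ ∞ ∧
      Tendsto (fun l => ∏ i ∈ Finset.range m, gq κ x0 (F l) i) atTop
        (𝓝 (∏ i ∈ Finset.range m, gq κ x0 f i)) := by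
    intro m
    induction m with
    | zero => intro _; simp
    | succ m ih =>
      intro hm
      obtain ⟨h1, h2⟩ := ih (by omega)
      have hqt : gq κ x0 f m ≠ ∞ := ne_top_of_le_ne_top ENNReal.one_ne_top (hq1 m (by omega))
      simp only [Finset.prod_range_succ]
      exact ⟨ENNReal.mul_ne_top h1 hqt,
        ENNReal.Tendsto.mul h2 (Or.inr hqt) (hq m (by omega)) (Or.inr h1)⟩
  have e : ∀ l, ∫⁻ x, gtm c (y l) (F l) n x ∂(gU κ x0 (F l) n) = _ := fun l =>
    lintegral_gtm hκ (hF l) hn (hF0 l) (y l)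
  simp only [e]
  rw [lintegral_gtm hκ hf hn hf0 z]
  obtain ⟨a1, a2⟩ := hP n hn.le
  obtain ⟨b1, b2⟩ := hP (n+1) hn
  refine Tendsto.add (ENNReal.Tendsto.mul b2 (Or.inr hmt) hm (Or.inr b1)) ?_
  refine ENNReal.Tendsto.mul_const (ENNReal.Tendsto.sub a2 b2 (Or.inl a1)) (Or.inr (hc n hn))

lemma conv_est {g : ℕ → X → ℝ≥0∞} (hg : GPol L g) (hκ : Measurable κ) (hc : ∀ n < L, c n ≠ ∞)
    {y : ℕ → ℕ → X} {z : ℕ → X} (hy : ∀ n < L, Tendsto (fun l => y l n) atTop (𝓝 (z n)))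
    (hfin : gC κ x0 c L z g ≠ ∞) :
    Tendsto (fun l => gC κ x0 c L (y l) g) atTop (𝓝 (gC κ x0 c L z g)) := by
  unfold gC at *
  refine tendsto_finsetSum _ fun n hn => ?_
  rw [ENNReal.sum_ne_top] at hfin
  have hfn := hfin n hn
  rw [Finset.mem_range] at hn
  have hgm := (hg n hn).1
  refine tendsto_lintegral_filter_of_dominated_convergence
    (fun x => 2 * gtm c z g n x + 2) ?_ ?_ ?_ ?_
  · exact Eventually.of_forall fun l => measurable_gtm _ hg hn
  · filter_upwards [Metric.tendsto_nhds.1 (hy n hn) 1 one_pos] with l hl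
    refine Eventually.of_forall fun x => ?_
    have h1 : dist x (y l n) ^ 2 ≤ 2 * dist x (z n) ^ 2 + 2 := by
      have h2 := dist_triangle x (z n) (y l n)
      rw [dist_comm (z n)] at h2
      have h3 : dist x (y l n) ≤ dist x (z n) + 1 := by linarith
      have h4 := pow_le_pow_left₀ dist_nonneg h3 2
      nlinarith [sq_nonneg (dist x (z n) - 1)]
    have h5 : ENNReal.ofReal (dist x (y l n) ^ 2) ≤ 2 * ENNReal.ofReal (dist x (z n) ^ 2) + 2 := by
      refine (ENNReal.ofReal_le_ofReal h1).trans ?_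
      rw [ENNReal.ofReal_add (by positivity) (by positivity), ENNReal.ofReal_mul (by positivity)]
      simp
    simp only [gtm]
    calc _ ≤ g n x * (2 * ENNReal.ofReal (dist x (z n) ^ 2) + 2) + (1 - g n x) * c n := by gcongr
      _ = 2 * (g n x * ENNReal.ofReal (dist x (z n) ^ 2)) + (1 - g n x) * c n + g n x * 2 := by ring
      _ ≤ 2 * (g n x * ENNReal.ofReal (dist x (z n) ^ 2)) + 2 * ((1 - g n x) * c n) + 1 * 2 := by
          exact add_le_add (add_le_add le_rfl (by rw [two_mul]; exact le_self_add))
            (mul_le_mul' ((hg n hn).2 x) le_rfl)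
      _ = _ := by ring
  · rw [lintegral_add_right _ measurable_const, lintegral_const_mul _ (measurable_gtm _ hg hn),
      lintegral_const]
    refine ENNReal.add_ne_top.2 ⟨ENNReal.mul_ne_top (by simp) hfn, ENNReal.mul_ne_top (by simp) ?_⟩
    exact ne_top_of_le_ne_top ENNReal.one_ne_top (gU_univ_le hκ hg n hn.le)
  · refine Eventually.of_forall fun x => ?_
    simp only [gtm]
    have h1 : Tendsto (fun l => ENNReal.ofReal (dist x (y l n) ^ 2)) atTop
        (𝓝 (ENNReal.ofReal (dist x (z n) ^ 2))) :=
      ENNReal.tendsto_ofReal ((tendsto_const_nhds.dist (hy n hn)).pow 2)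
    have hgt : g n x ≠ ∞ := ne_top_of_le_ne_top ENNReal.one_ne_top ((hg n hn).2 x)
    exact (ENNReal.Tendsto.const_mul h1 (Or.inr hgt)).add tendsto_const_nhds

theorem gen_partB {F : ℕ → ℕ → X → ℝ≥0∞} {xs : ℕ → ℕ → X}
    (hκ : Measurable κ) (hc : ∀ n < L, c n ≠ ∞) (hF : ∀ i, GPol L (F i)) (hf : GPol L f)
    (hopt : ∀ i g, GPol L g → gC κ x0 c L (xs i) (F i) ≤ gC κ x0 c L (xs i) g)
    (hX : ∀ i y, gC κ x0 c L (xs (i + 1)) (F i) ≤ gC κ x0 c L y (F i))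
    (hF0 : ∀ i, ∀ n < L, gq κ x0 (F i) n ≠ 0) (hf0 : ∀ n < L, gq κ x0 f n ≠ 0) {R : ℝ}
    (hR : ∀ n < L, ∀ i, ∀ᵐ x ∂(gcond (F i) n (gm κ x0 (F i) n)), dist x x0 ≤ R)
    {φ : ℕ → ℕ} (hφ : StrictMono φ)
    (hw : ∀ n < L, GWeak (fun l => gcond (F (φ l)) n (gm κ x0 (F (φ l)) n))
      (gcond f n (gm κ x0 f n)))
    (hq : ∀ n < L, Tendsto (fun l => gq κ x0 (F (φ l)) n) atTop (𝓝 (gq κ x0 f n)))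
    {xh : ℕ → X} (hy : ∀ n < L, Tendsto (fun l => xs (φ l + 1) n) atTop (𝓝 (xh n))) :
    (∀ g, GPol L g → gC κ x0 c L xh f ≤ gC κ x0 c L xh g) ∧
      ∀ y, gC κ x0 c L xh f ≤ gC κ x0 c L y f := by
  have hlim : ∀ (y : ℕ → ℕ → X) (z : ℕ → X),
      (∀ n < L, Tendsto (fun l => y l n) atTop (𝓝 (z n))) →
      Tendsto (fun l => gC κ x0 c L (y l) (F (φ l))) atTop (𝓝 (gC κ x0 c L z f)) := fun y z h =>
    conv_cost (F := fun l => F (φ l)) hκ hc (fun l => hF _) hf (fun l => hF0 _) hf0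
      (fun n hn l => hR n hn _) hw hq h
  have h1 := hlim (fun l => xs (φ l + 1)) xh hy
  constructor
  · intro g hg
    by_cases hfin : gC κ x0 c L xh g = ∞
    · rw [hfin]; exact le_top
    let G : ℕ → ℝ≥0∞ := fun i => gC κ x0 c L (xs i) (F i)
    let a : ℕ → ℝ≥0∞ := fun i => gC κ x0 c L (xs (i + 1)) (F i)
    have hGa : ∀ i, G (i + 1) ≤ a i := fun i => hopt (i + 1) (F i) (hF i)
    have haG : ∀ i, a i ≤ G i := fun i => hX i (xs i)
    have hanti : Antitone G := antitone_nat_of_succ_le fun i => (hGa i).trans (haG i)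
    have hG := tendsto_atTop_iInf hanti
    have hG1 : Tendsto (fun i => G (i + 1)) atTop (𝓝 (⨅ i, G i)) :=
      hG.comp (tendsto_add_atTop_nat 1)
    have ha : Tendsto a atTop (𝓝 (⨅ i, G i)) :=
      tendsto_of_tendsto_of_tendsto_of_le_of_le hG1 hG hGa haG
    have hu : gC κ x0 c L xh f = ⨅ i, G i :=
      tendsto_nhds_unique h1 (ha.comp hφ.tendsto_atTop)
    rw [hu]
    exact le_of_tendsto_of_tendsto' (hG1.comp hφ.tendsto_atTop) (conv_est hg hκ hc hy hfin)
      (fun l => hopt (φ l + 1) g hg)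
  · intro y
    exact le_of_tendsto_of_tendsto' h1 (hlim (fun _ => y) y fun n _ => tendsto_const_nhds)
      (fun l => hX (φ l) y)

end Gen


def eS (x : S) : EuclideanSpace ℝ (Fin 4) :=
  !₂[x.1.1, x.1.2.1, √2 * Real.cos x.1.2.2, √2 * Real.sin x.1.2.2]

lemma dist_eS (x y : S) : dist (eS x) (eS y) = dS x y := by
  have h2 : (√2 : ℝ) ^ 2 = 2 := Real.sq_sqrt (by norm_num)
  rw [EuclideanSpace.dist_eq]
  simp only [Fin.sum_univ_four, eS, Real.dist_eq, sq_abs, dS]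
  simp
  congr 1
  linear_combination ((Real.cos x.1.2.2 - Real.cos y.1.2.2) ^ 2 +
    (Real.sin x.1.2.2 - Real.sin y.1.2.2) ^ 2) * h2

lemma eS_inj : Function.Injective eS := by
  intro x y h
  have hs : (√2 : ℝ) ≠ 0 := by positivity
  have h0 := congrArg (fun v : EuclideanSpace ℝ (Fin 4) => v 0) h
  have h1 := congrArg (fun v : EuclideanSpace ℝ (Fin 4) => v 1) h
  have h2 := congrArg (fun v : EuclideanSpace ℝ (Fin 4) => v 2) h
  have h3 := congrArg (fun v : EuclideanSpace ℝ (Fin 4) => v 3) h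
  simp [eS] at h0 h1 h2 h3
  have h4 := Real.Angle.cos_sin_inj h2 h3
  rw [Real.Angle.angle_eq_iff_two_pi_dvd_sub] at h4
  obtain ⟨m, hm⟩ := h4
  obtain ⟨⟨a, b, t⟩, ht0, ht1⟩ := x
  obtain ⟨⟨a', b', t'⟩, ht0', ht1'⟩ := y
  simp only at *
  have hp := Real.two_pi_pos
  have hm1 : (m : ℝ) < 1 := by by_contra! hh; nlinarith
  have hm2 : (-1 : ℝ) < m := by by_contra! hh; nlinarith
  have hm0 : m = 0 := by
    have : m < 1 := by exact_mod_cast hm1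
    have : -1 < m := by exact_mod_cast hm2
    omega
  subst hm0
  have : t = t' := by simp at hm; linarith
  subst h0 h1 this
  rfl

lemma range_eS : Set.range eS = {v | v 2 ^ 2 + v 3 ^ 2 = 2} := by
  have h2 : (√2 : ℝ) ^ 2 = 2 := Real.sq_sqrt (by norm_num)
  have hs : (√2 : ℝ) ≠ 0 := by positivity
  ext v
  constructor
  · rintro ⟨x, rfl⟩
    simp only [eS, Set.mem_ofPred_eq]
    simp
    linear_combination 2 * Real.sin_sq_add_cos_sq x.1.2.2 + (Real.sin x.1.2.2 ^ 2 + Real.cos x.1.2.2 ^ 2) * h2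
  · intro hv
    simp only [Set.mem_ofPred_eq] at hv
    let z : ℂ := ⟨v 2 / √2, v 3 / √2⟩
    have hz : ‖z‖ = 1 := by
      rw [Complex.norm_eq_sqrt_sq_add_sq]
      simp only [z]
      rw [div_pow, div_pow, h2, ← add_div, hv]; norm_num
    have hz0 : z ≠ 0 := by
      intro h; rw [h] at hz; simp at hz
    let t := toIcoMod Real.two_pi_pos 0 z.arg
    have ht : t ∈ Set.Ico 0 (2 * Real.pi) := by
      have := toIcoMod_mem_Ico Real.two_pi_pos 0 z.arg
      simpa [t] using this
    have hc : Real.cos t = v 2 / √2 := by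
      have : Real.cos t = Real.cos z.arg := Real.cos_periodic.sub_zsmul_eq _
      rw [this, Complex.cos_arg hz0, hz]; simp [z]
    have hsn : Real.sin t = v 3 / √2 := by
      have : Real.sin t = Real.sin z.arg := Real.sin_periodic.sub_zsmul_eq _
      rw [this, Complex.sin_arg, hz]; simp [z]
    refine ⟨⟨(v 0, v 1, t), ht⟩, ?_⟩
    ext i
    fin_cases i
    · simp [eS]
    · simp [eS]
    · simp [eS, hc]; field_simp
    · simp [eS, hsn]; field_simp

lemma measurable_eS : Measurable eS := by
  have : Continuous eS := by
    unfold eS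
    fun_prop
  exact this.measurable

def T : Type := S

instance : MeasurableSpace T := inferInstanceAs (MeasurableSpace S)

def eT (x : T) : EuclideanSpace ℝ (Fin 4) := eS x

instance : MetricSpace T := MetricSpace.induced eT eS_inj inferInstance

lemma dist_T (x y : T) : dist x y = dS x y := dist_eS x y

lemma isom_eT : Isometry eT := Isometry.of_dist_eq fun _ _ => rfl

lemma closedEmb_eT : Topology.IsClosedEmbedding eT := by
  refine ⟨isom_eT.isEmbedding, ?_⟩
  have : Set.range eT = {v | v 2 ^ 2 + v 3 ^ 2 = 2} := range_eS
  rw [this]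
  exact isClosed_eq (by fun_prop) continuous_const

instance : ProperSpace T := ⟨fun x r => by
  have := closedEmb_eT.isCompact_preimage (isCompact_closedBall (eT x) r)
  exact this⟩

instance : BorelSpace T := ⟨by
  have : StandardBorelSpace S := by
    have hm : MeasurableSet {x : ℝ × ℝ × ℝ | x.2.2 ∈ Set.Ico (0 : ℝ) (2 * Real.pi)} :=
      measurableSet_Ico.preimage (by fun_prop)
    exact hm.standardBorel
  have h1 : MeasurableEmbedding eS := measurable_eS.measurableEmbedding eS_inj
  have h2 := h1.comap_eq
  have h3 : (borel (EuclideanSpace ℝ (Fin 4))).comap eT = borel T := borel_comap.symm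
  rw [← h3, ← BorelSpace.measurable_eq (α := EuclideanSpace ℝ (Fin 4))]
  exact h2.symm⟩


def toK (κ : S → Measure S) : T → Measure T := κ
def toF (k : ℕ) (f : ℕ → S → ℝ≥0∞) : ℕ → T → ℝ≥0∞ := fun n => f (k + n)
def toX (k : ℕ) (x : ℕ → S) : ℕ → T := fun n => x (k + n)
def toc (k : ℕ) (c' : ℕ → ℝ) : ℕ → ℝ≥0∞ := fun n => ENNReal.ofReal (c' (k + n))
def o : T := origin
def ofF (k : ℕ) (f : ℕ → T → ℝ≥0∞) : ℕ → S → ℝ≥0∞ := fun j => f (j - k)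
def ofX (k : ℕ) (x : ℕ → T) : ℕ → S := fun j => x (j - k)

lemma toF_ofF (k : ℕ) (f : ℕ → T → ℝ≥0∞) : toF k (ofF k f) = f := by
  funext n; simp only [toF, ofF, Nat.add_sub_cancel_left]
lemma toX_ofX (k : ℕ) (x : ℕ → T) : toX k (ofX k x) = x := by
  funext n; simp only [toX, ofX, Nat.add_sub_cancel_left]

lemma isPolicy_iff {k N : ℕ} {f : ℕ → S → ℝ≥0∞} :
    IsPolicy k N f ↔ GPol (N + 1 - k) (toF k f) := by
  constructor
  · intro h n hn
    exact h (k + n) (by omega) (by omega)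
  · intro h j h1 h2
    have := h (j - k) (by omega)
    have e : k + (j - k) = j := by omega
    simp only [toF, e] at this
    exact this

lemma Vaux_eq (κ : S → Measure S) (c' : ℕ → ℝ) (xhat : ℕ → S) (f : ℕ → S → ℝ≥0∞) (k : ℕ) :
    ∀ m n (x : S), Vaux κ c' xhat f m (k + n) x
      = gV (toK κ) (toc k c') (toX k xhat) (toF k f) m n x
  | 0, _, _ => rfl
  | m + 1, n, x => by
    have ih : Vaux κ c' xhat f m (k + n + 1)
      = gV (toK κ) (toc k c') (toX k xhat) (toF k f) m (n + 1) :=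
      funext fun y => Vaux_eq κ c' xhat f k m (n + 1) y
    simp only [Vaux, gV, ih]
    have hd : dS x (xhat (k + n)) = dist (α := T) x (toX k xhat n) := (dist_T _ _).symm
    rw [hd]
    rfl

lemma Cost_eq {κ : S → Measure S} [hp : ∀ x, IsProbabilityMeasure (toK κ x)]
    (hκ : Measurable (toK κ)) (c' : ℕ → ℝ) {k N : ℕ}
    (xhat : ℕ → S) {f : ℕ → S → ℝ≥0∞} (hf : IsPolicy k N f) :
    Cost κ c' k N xhat f
      = gC (toK κ) o (toc k c') (N + 1 - k) (toX k xhat) (toF k f) := by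
  rw [← gC_eq hκ _ (isPolicy_iff.1 hf)]
  have : VV κ c' N xhat f k
      = gV (toK κ) (toc k c') (toX k xhat) (toF k f) (N + 1 - k) 0 :=
    funext fun y => Vaux_eq κ c' xhat f k _ 0 y
  simp only [Cost, this]
  rfl

lemma mupredAux_eq (κ : S → Measure S) (f : ℕ → S → ℝ≥0∞) (k : ℕ) :
    ∀ n, mupredAux κ f k n = gm (toK κ) o (toF k f) n
  | 0 => rfl
  | n + 1 => by
    simp only [mupredAux, gm]
    rw [mupredAux_eq κ f k n]
    rfl

lemma mupred_eq (κ : S → Measure S) (f : ℕ → S → ℝ≥0∞) (k n : ℕ) :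
    mupred κ f k (k + n) = gm (toK κ) o (toF k f) n := by
  rw [mupred, Nat.add_sub_cancel_left, mupredAux_eq]

lemma qq_eq (κ : S → Measure S) (f : ℕ → S → ℝ≥0∞) (k n : ℕ) :
    qq κ f k (k + n) = gq (toK κ) o (toF k f) n := by
  rw [qq, mupred_eq]; rfl

lemma mucond_eq (κ : S → Measure S) (f : ℕ → S → ℝ≥0∞) (k n : ℕ) :
    mucond κ f k (k + n) = gcond (toF k f) n (gm (toK κ) o (toF k f) n) := by
  rw [mucond, mupred_eq]; rfl

lemma dcont_iff (h : S → ℝ) : DContinuous h ↔ Continuous (X := T) h := by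
  refine Iff.trans ?_ (Metric.continuous_iff (α := T) (f := h)).symm
  constructor
  · intro H x ε hε
    obtain ⟨δ, hδ, hh⟩ := H x ε hε
    refine ⟨δ, hδ, fun y hy => hh y ?_⟩
    rw [dist_comm] at hy
    exact (dist_T x y) ▸ hy
  · intro H x ε hε
    obtain ⟨δ, hδ, hh⟩ := H x ε hε
    refine ⟨δ, hδ, fun y hy => hh y ?_⟩
    exact lt_of_eq_of_lt ((dist_comm (α := T) y x).trans (dist_T x y)) hy

lemma weak_iff (μl : ℕ → Measure S) (μ : Measure S) :
    WeakConvS μl μ ↔ GWeak (X := T) μl μ := by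
  constructor
  · intro H h hh hb
    exact H h ((dcont_iff h).2 hh) hb
  · intro H h hh hb
    exact H h ((dcont_iff h).1 hh) hb

lemma forall_idx {k N : ℕ} (hkN : k ≤ N) {P : ℕ → Prop} :
    (∀ j, k ≤ j → j ≤ N → P j) ↔ ∀ n < N + 1 - k, P (k + n) := by
  constructor
  · intro h n hn; exact h _ (by omega) (by omega)
  · intro h j h1 h2
    have := h (j - k) (by omega)
    rwa [show k + (j - k) = j by omega] at this

lemma polConv_iff {κ : S → Measure S} {k N : ℕ} (hkN : k ≤ N) {g : ℕ → ℕ → S → ℝ≥0∞}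
    {f : ℕ → S → ℝ≥0∞} : PolConv κ k N g f ↔ ∀ n < N + 1 - k,
      GWeak (fun l => gcond (toF k (g l)) n (gm (toK κ) o (toF k (g l)) n))
          (gcond (toF k f) n (gm (toK κ) o (toF k f) n)) ∧
        Tendsto (fun l => gq (toK κ) o (toF k (g l)) n) atTop (𝓝 (gq (toK κ) o (toF k f) n)) := by
  rw [PolConv, forall_idx hkN]
  simp only [qq_eq, mucond_eq]
  exact forall₂_congr fun n _ => and_congr (weak_iff _ _) Iff.rfl

lemma nonDeg_iff {κ : S → Measure S} {k N : ℕ} (hkN : k ≤ N) 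
    {f : ℕ → S → ℝ≥0∞} : NonDeg κ f k N ↔ ∀ n < N + 1 - k, gq (toK κ) o (toF k f) n ≠ 0 := by
  rw [NonDeg, forall_idx hkN]
  simp only [qq_eq, pos_iff_ne_zero]

lemma tend_iff {k N : ℕ} (hkN : k ≤ N) {y : ℕ → ℕ → S} {z : ℕ → S} :
    (∀ j, k ≤ j → j ≤ N → Tendsto (fun l => dS (y l j) (z j)) atTop (𝓝 0)) ↔
    ∀ n < N + 1 - k, Tendsto (fun l => toX k (y l) n) atTop (𝓝 (toX k z n)) := by
  rw [forall_idx hkN]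
  refine forall₂_congr fun n _ => ?_
  rw [tendsto_iff_dist_tendsto_zero (f := fun l => toX k (y l) n)]
  simp only [dist_T]
  rfl

/-- Convergence of the iterative procedure to a person-by-person optimal solution:
(a) the alternating best-response sequence has a convergent subsequence; (b) every
limit of a convergent subsequence is person-by-person optimal. (Here `fseq i`
plays the role of `f^(i+1)` and `xhat i` that of `x̂^(i)`, so `fseq i ∈ 𝔓(xhat i)`
and `xhat (i+1) ∈ 𝔛(fseq i)`.) -/
theorem procedure_converges_to_pbp_optimal (κ : S → Measure S) (hκ : IsMarkov κ)
    (hA : Assumption1 κ)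
    (k N : ℕ) (hkN : k ≤ N) (c' : ℕ → ℝ) (hc' : ∀ j, k ≤ j → j ≤ N → 0 < c' j)
    (xhat : ℕ → ℕ → S) (fseq : ℕ → ℕ → S → ℝ≥0∞)
    (hPX : ∀ i, inP κ c' k N (xhat i) (fseq i) ∧ inX κ c' k N (fseq i) (xhat (i + 1)))
    (ε : ℝ≥0∞) (hε : 0 < ε)
    (hsnd : ∀ i j, k ≤ j → j ≤ N → ε ≤ qq κ (fseq i) k j) :
    -- (a) existence of a convergent subsequence
    (∃ φ : ℕ → ℕ, StrictMono φ ∧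
      ∃ (f : ℕ → S → ℝ≥0∞) (xh : ℕ → S),
        IsPolicy k N f ∧ NonDeg κ f k N ∧
        PolConv κ k N (fun l => fseq (φ l)) f ∧
        ∀ j, k ≤ j → j ≤ N →
          Tendsto (fun l => dS (xhat (φ l + 1) j) (xh j)) atTop (𝓝 0)) ∧
    -- (b) every limit of a convergent subsequence is person-by-person optimal
    (∀ (φ : ℕ → ℕ) (f : ℕ → S → ℝ≥0∞) (xh : ℕ → S), StrictMono φ →
      IsPolicy k N f → NonDeg κ f k N →
      PolConv κ k N (fun l => fseq (φ l)) f →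
      (∀ j, k ≤ j → j ≤ N →
        Tendsto (fun l => dS (xhat (φ l + 1) j) (xh j)) atTop (𝓝 0)) →
      inP κ c' k N xh f ∧ inX κ c' k N f xh) := by
  have hp : ∀ x, IsProbabilityMeasure (toK κ x) := hκ.1
  have hκm : Measurable (toK κ) :=
    Measure.measurable_of_measurable_coe _ fun A hAm => hκ.2 A hAm
  have hcont : ∀ A, MeasurableSet A → Continuous fun x => toK κ x A := by
    intro A hAm
    have h1 := (dcont_iff _).1 (hA.1 A hAm)
    have h2 := ENNReal.continuous_ofReal.comp h1
    refine h2.congr fun x => ?_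
    exact ENNReal.ofReal_toReal (measure_ne_top (toK κ x) A)
  have hc : ∀ n < N + 1 - k, toc k c' n ≠ ∞ := fun n _ => ENNReal.ofReal_ne_top
  have hF : ∀ i, GPol (N + 1 - k) (toF k (fseq i)) := fun i => isPolicy_iff.1 (hPX i).1.1
  have hopt : ∀ i g, GPol (N + 1 - k) g →
      gC (toK κ) o (toc k c') (N + 1 - k) (toX k (xhat i)) (toF k (fseq i))
        ≤ gC (toK κ) o (toc k c') (N + 1 - k) (toX k (xhat i)) g := by
    intro i g hg
    have hg' : IsPolicy k N (ofF k g) := isPolicy_iff.2 (by rwa [toF_ofF])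
    have := (hPX i).1.2 _ hg'
    rwa [Cost_eq hκm c' _ hg', Cost_eq hκm c' _ (hPX i).1.1, toF_ofF] at this
  have hX : ∀ i y, gC (toK κ) o (toc k c') (N + 1 - k) (toX k (xhat (i + 1))) (toF k (fseq i))
        ≤ gC (toK κ) o (toc k c') (N + 1 - k) y (toF k (fseq i)) := by
    intro i y
    have := (hPX i).2 (ofX k y)
    rwa [Cost_eq hκm c' _ (hPX i).1.1, Cost_eq hκm c' _ (hPX i).1.1, toX_ofX] at this
  have hq : ∀ i, ∀ n < N + 1 - k, ε ≤ gq (toK κ) o (toF k (fseq i)) n := by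
    intro i n hn
    rw [← qq_eq]
    exact hsnd i _ (by omega) (by omega)
  obtain ⟨R, hR⟩ := bdd_all (F := fun i => toF k (fseq i)) (xs := fun i => toX k (xhat i))
    hκm hcont hF hc hopt hε hq
  constructor
  · obtain ⟨φ, hφ, f, xh, hf, hf0, hlim⟩ := gen_partA (F := fun i => toF k (fseq i))
      (ys := fun i => toX k (xhat (i + 1))) hκm hcont hF hε hq
      (R := R) (fun n hn i => ⟨(hR n hn (i + 1)).1, (hR n hn i).2⟩)
    refine ⟨φ, hφ, ofF k f, ofX k xh, isPolicy_iff.2 (by rwa [toF_ofF]),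
      (nonDeg_iff hkN).2 (by rwa [toF_ofF]), (polConv_iff hkN).2 ?_,
      (tend_iff hkN (y := fun l => xhat (φ l + 1))).2 ?_⟩
    · rw [toF_ofF]
      exact fun n hn => ⟨(hlim n hn).1, (hlim n hn).2.1⟩
    · rw [toX_ofX]
      exact fun n hn => (hlim n hn).2.2
  · intro φ f xh hφ hf hnd hpc hxh
    have hpc' := (polConv_iff hkN).1 hpc
    have hxh' := (tend_iff hkN (y := fun l => xhat (φ l + 1))).1 hxh
    obtain ⟨hB1, hB2⟩ := gen_partB (F := fun i => toF k (fseq i)) (xs := fun i => toX k (xhat i))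
      hκm hc hF (isPolicy_iff.1 hf) hopt hX (fun i n hn => (hε.trans_le (hq i n hn)).ne')
      ((nonDeg_iff hkN).1 hnd) (fun n hn i => (hR n hn i).2) hφ
      (fun n hn => (hpc' n hn).1) (fun n hn => (hpc' n hn).2) hxh'
    refine ⟨⟨hf, fun g hg => ?_⟩, fun y => ?_⟩
    · rw [Cost_eq hκm c' _ hf, Cost_eq hκm c' _ hg]
      exact hB1 _ (isPolicy_iff.1 hg)
    · rw [Cost_eq hκm c' _ hf, Cost_eq hκm c' _ hf]
      exact hB2 _


end
end
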